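/- arXiv:2002.12785 — 7 statements merged into one kernel-verified Lean document; each statement's English description precedes it below -/
import Mathlib

section
/- Let n, m, σ, w be positive integers with m odd, 1 ≤ w ≤ n·⌊m/2⌋ and σ ≤ min{n, w}. Then the number of vectors v ∈ (ℤ/mℤ)^n with exactly σ nonzero coordinates and Lee weight w equals binom(n, σ) · 2^σ · C(w, σ, ⌊m/2⌋). -/
/-- Lee weight of an element of `ℤ/mℤ`. -/
def leeWt {m : ℕ} (x : ZMod m) : ℕ := min x.val (m - x.val)

/-- Lee weight of a vector over `ℤ/mℤ`. -/
def leeWtVec {n m : ℕ} (v : Fin n → ZMod m) : ℕ := ∑ i, leeWt (v i)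

/-- `compCount w σ η` is the number of compositions of `w` into exactly `σ` parts,
each part an integer between `1` and `η` inclusive. -/
def compCount (w σ η : ℕ) : ℕ :=
  ((Fintype.piFinset fun _ : Fin σ => Finset.Icc 1 η).filter fun f => ∑ i, f i = w).card

/-- `fCount n σ w m` is the number of vectors in `(ℤ/mℤ)^n` with support of size `σ`
and Lee weight `w`. -/
noncomputable def fCount (n σ w m : ℕ) : ℕ :=
  Nat.card {v : Fin n → ZMod m //
    (Finset.univ.filter fun i => v i ≠ 0).card = σ ∧ leeWtVec v = w}

theorem leeWt_eq_zero_iff {m : ℕ} [NeZero m] (x : ZMod m) : leeWt x = 0 ↔ x = 0 := by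
  have := ZMod.val_lt x
  rw [← ZMod.val_eq_zero, leeWt]
  omega

theorem leeWt_le_half {m : ℕ} (x : ZMod m) : leeWt x ≤ m / 2 := by
  rw [leeWt]
  omega

/-- For odd `m`, each possible positive Lee weight is attained by exactly two residues. -/
theorem card_filter_leeWt_eq {m a : ℕ} [NeZero m] (hm : Odd m) (ha : 1 ≤ a) (ham : a ≤ m / 2) :
    (Finset.univ.filter fun x : ZMod m => leeWt x = a).card = 2 := by
  obtain ⟨k, hk⟩ := hm
  have hval : (a : ZMod m).val = a := ZMod.val_natCast_of_lt (by omega)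
  have hval' : ((m - a : ℕ) : ZMod m).val = m - a := ZMod.val_natCast_of_lt (by omega)
  have hset : (Finset.univ.filter fun x : ZMod m => leeWt x = a) =
      {(a : ZMod m), ((m - a : ℕ) : ZMod m)} := by
    ext x
    have hx := ZMod.val_lt x
    rw [Finset.mem_filter_univ, Finset.mem_insert, Finset.mem_singleton,
      ← (ZMod.val_injective m).eq_iff, ← (ZMod.val_injective m).eq_iff, hval, hval', leeWt]
    omega
  rw [hset, Finset.card_pair]
  intro h
  have := congrArg ZMod.val h
  omega

/-- The vectors with a prescribed vector of Lee weights `h` number `2` to the size of the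
support of `h`, for odd `m`. -/
theorem card_filter_leeWt_comp_eq {ι : Type*} [Fintype ι] [DecidableEq ι] {m : ℕ} [NeZero m]
    (hm : Odd m) (h : ι → ℕ) (hle : ∀ i, h i ≤ m / 2) :
    (Finset.univ.filter fun v : ι → ZMod m => (fun i => leeWt (v i)) = h).card =
      2 ^ (Finset.univ.filter fun i => h i ≠ 0).card := by
  have hset : (Finset.univ.filter fun v : ι → ZMod m => (fun i => leeWt (v i)) = h) =
      Fintype.piFinset fun i => Finset.univ.filter fun x : ZMod m => leeWt x = h i := by
    ext v
    simp [funext_iff]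
  rw [hset, Fintype.card_piFinset, ← Finset.prod_const, Finset.prod_filter]
  refine Finset.prod_congr rfl fun i _ => ?_
  split_ifs with hi
  · exact card_filter_leeWt_eq hm (Nat.one_le_iff_ne_zero.mpr hi) (hle i)
  · rw [not_not.mp hi]
    simp only [leeWt_eq_zero_iff]
    exact Finset.card_eq_one.mpr ⟨0, by ext; simp⟩

/-- Vectors of naturals bounded by `η` with sum `w` and support exactly `S` correspond to
compositions of `w` into `S.card` parts. -/
theorem card_filter_support_eq_compCount {n : ℕ} (w η : ℕ) (S : Finset (Fin n)) :
    ((Fintype.piFinset fun _ : Fin n => Finset.range (η + 1)).filter fun h =>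
      (Finset.univ.filter fun i => h i ≠ 0) = S ∧ ∑ i, h i = w).card =
      compCount w S.card η := by
  set e := S.orderEmbOfFin rfl
  have hmem : ∀ j, e j ∈ S := fun j => S.orderEmbOfFin_mem rfl j
  have hsurj : ∀ i ∈ S, ∃ j, e j = i := fun i hi => by
    have : i ∈ Set.range e := by rw [Finset.range_orderEmbOfFin]; exact hi
    exact this
  have hsum : ∀ h : Fin n → ℕ, (∀ i, i ∉ S → h i = 0) → ∑ j, h (e j) = ∑ i, h i := by
    intro h hh
    rw [← Finset.sum_subset (Finset.subset_univ S) fun i _ hi => hh i hi]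
    refine Finset.sum_bij (fun j _ => e j) (fun j _ => hmem j)
      (fun _ _ _ _ h => e.injective h) (fun i hi => ?_) fun _ _ => rfl
    obtain ⟨j, rfl⟩ := hsurj i hi
    exact ⟨j, Finset.mem_univ _, rfl⟩
  have hout : ∀ f : Fin S.card → ℕ, ∀ i, i ∉ S → Function.extend e f 0 i = 0 := by
    intro f i hi
    refine Function.extend_apply' _ _ _ ?_
    rintro ⟨j, rfl⟩
    exact hi (hmem j)
  unfold compCount
  refine Finset.card_nbij' (fun h j => h (e j)) (fun f => Function.extend e f 0) ?_ ?_ ?_ ?_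
  · intro h hh
    simp only [Finset.coe_filter, Set.mem_ofPred_eq, Fintype.mem_piFinset, Finset.mem_range,
      Finset.mem_Icc, Finset.ext_iff, Finset.mem_filter, Finset.mem_univ, true_and] at hh ⊢
    obtain ⟨hle, hS, hw⟩ := hh
    refine ⟨fun j => ⟨Nat.one_le_iff_ne_zero.mpr ((hS _).mpr (hmem j)),
      Nat.lt_succ_iff.mp (hle _)⟩, ?_⟩
    rw [hsum h fun i hi => not_not.mp (mt (hS i).mp hi), hw]
  · intro f hf
    simp only [Finset.coe_filter, Set.mem_ofPred_eq, Fintype.mem_piFinset, Finset.mem_range,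
      Finset.mem_Icc, Finset.ext_iff, Finset.mem_filter, Finset.mem_univ, true_and] at hf ⊢
    obtain ⟨hf, hw⟩ := hf
    refine ⟨fun i => ?_, fun i => ?_, ?_⟩
    · by_cases hi : i ∈ S
      · obtain ⟨j, rfl⟩ := hsurj i hi
        rw [e.injective.extend_apply]
        exact Nat.lt_succ_of_le (hf j).2
      · rw [hout f i hi]
        exact Nat.succ_pos η
    · by_cases hi : i ∈ S
      · obtain ⟨j, rfl⟩ := hsurj i hi
        rw [e.injective.extend_apply]
        exact iff_of_true (Nat.one_le_iff_ne_zero.mp (hf j).1) hi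
      · exact iff_of_false (not_not.mpr (hout f i hi)) hi
    · rw [← hsum _ (hout f)]
      simpa only [e.injective.extend_apply] using hw
  · intro h hh
    simp only [Finset.coe_filter, Set.mem_ofPred_eq, Finset.ext_iff, Finset.mem_filter,
      Finset.mem_univ, true_and] at hh
    funext i
    by_cases hi : i ∈ S
    · obtain ⟨j, rfl⟩ := hsurj i hi
      exact e.injective.extend_apply _ _ j
    · exact (hout _ i hi).trans (not_not.mp (mt (hh.2.1 i).mp hi)).symm
  · intro f _
    funext j
    exact e.injective.extend_apply f 0 j

/-- Vectors of naturals bounded by `η` with sum `w` and support of size `σ`. -/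
theorem card_filter_card_support_eq (n σ w η : ℕ) :
    ((Fintype.piFinset fun _ : Fin n => Finset.range (η + 1)).filter fun h =>
      (Finset.univ.filter fun i => h i ≠ 0).card = σ ∧ ∑ i, h i = w).card =
      n.choose σ * compCount w σ η := by
  rw [Finset.card_eq_sum_card_fiberwise
    (f := fun h : Fin n → ℕ => Finset.univ.filter fun i => h i ≠ 0)
    (t := Finset.powersetCard σ Finset.univ)]
  · rw [Finset.sum_congr rfl (g := fun _ => compCount w σ η), Finset.sum_const,
      Finset.card_powersetCard, Finset.card_univ, Fintype.card_fin, smul_eq_mul]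
    intro S hS
    obtain rfl := (Finset.mem_powersetCard.mp hS).2
    rw [← card_filter_support_eq_compCount, Finset.filter_filter]
    congr 1
    refine Finset.filter_congr fun h _ => ?_
    constructor
    · rintro ⟨⟨-, hw⟩, hS⟩
      exact ⟨hS, hw⟩
    · rintro ⟨hS, hw⟩
      exact ⟨⟨congrArg Finset.card hS, hw⟩, hS⟩
  · intro h hh
    simp only [Finset.coe_filter, Set.mem_ofPred_eq] at hh
    exact Finset.mem_coe.mpr (Finset.mem_powersetCard.mpr ⟨Finset.subset_univ _, hh.2.1⟩)

theorem f_count_odd (n m σ w : ℕ) (hn : 0 < n) (hm0 : 0 < m) (hm : Odd m)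
    (hσpos : 0 < σ) (hw1 : 1 ≤ w) (hw2 : w ≤ n * (m / 2)) (hσ : σ ≤ min n w) :
    fCount n σ w m = n.choose σ * 2 ^ σ * compCount w σ (m / 2) := by
  have : NeZero m := ⟨hm0.ne'⟩
  have hsupp : ∀ v : Fin n → ZMod m, (Finset.univ.filter fun i => v i ≠ 0) =
      Finset.univ.filter fun i => leeWt (v i) ≠ 0 := fun v => by
    simp only [ne_eq, leeWt_eq_zero_iff]
  rw [fCount, Nat.card_eq_fintype_card, Fintype.card_subtype,
    Finset.card_eq_sum_card_fiberwise (f := fun (v : Fin n → ZMod m) i => leeWt (v i))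
      (t := (Fintype.piFinset fun _ : Fin n => Finset.range (m / 2 + 1)).filter fun h =>
        (Finset.univ.filter fun i => h i ≠ 0).card = σ ∧ ∑ i, h i = w)]
  · rw [Finset.sum_congr rfl (g := fun _ => 2 ^ σ), Finset.sum_const,
      card_filter_card_support_eq, smul_eq_mul, mul_right_comm]
    intro h hh
    simp only [Finset.mem_filter, Fintype.mem_piFinset, Finset.mem_range,
      Nat.lt_succ_iff] at hh
    obtain ⟨hle, hcard, hw⟩ := hh
    rw [← hcard, ← card_filter_leeWt_comp_eq hm h hle, Finset.filter_filter]
    congr 1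
    refine Finset.filter_congr fun v _ => and_iff_right_of_imp ?_
    rintro rfl
    exact ⟨by rw [hsupp v], hw⟩
  · intro v hv
    simp only [Finset.coe_filter, Finset.mem_univ, true_and, Set.mem_ofPred_eq,
      Fintype.mem_piFinset, Finset.mem_range, Nat.lt_succ_iff, hsupp] at hv ⊢
    exact ⟨fun i => leeWt_le_half _, hv⟩
end

section
/- (Gilbert–Varshamov bound, even case.) Let p^s be an even prime power (i.e., p = 2) and let n, k, d be positive integers with k ≤ n such that V_L(n, d−1, p^s) < 1 + ((p^s)^{n−k} − 1)/(p^s − 1). Then there exists an additive subgroup C of (ℤ/p^sℤ)^n with |C| = (p^s)^k whose minimum Lee distance is at least d. -/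
/-- `VL n w m` is the number of vectors in `(ℤ/mℤ)^n` of Lee weight at most `w`
(volume of the Lee ball of radius `w`). -/
noncomputable def VL (n w m : ℕ) : ℕ :=
  Nat.card {v : Fin n → ZMod m // leeWtVec v ≤ w}

/-- Midpoint inequality for the convex function `u ↦ (max u 0) ^ m`. -/
lemma midpoint_pow_max_le (m : ℕ) (u : ℝ) :
    ((m : ℝ) + 2) * max u 0 ^ (m + 1) ≤
      max (u + 1 / 2) 0 ^ (m + 2) - max (u - 1 / 2) 0 ^ (m + 2) := by
  rcases le_total u 0 with hu | hu
  · rw [max_eq_right hu, max_eq_right (by linarith : u - 1 / 2 ≤ 0)]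
    simp
  rw [max_eq_left hu, max_eq_left (by linarith : (0 : ℝ) ≤ u + 1 / 2)]
  rcases le_total u (1 / 2) with hu2 | hu2
  · rw [max_eq_right (by linarith : u - 1 / 2 ≤ 0)]
    simp only [ne_eq, Nat.add_eq_zero_iff, OfNat.ofNat_ne_zero, and_false, not_false_eq_true,
      zero_pow, sub_zero]
    induction m with
    | zero => norm_num; nlinarith [sq_nonneg (u - 1 / 2)]
    | succ m ih =>
      have h1 : (u + 1 / 2) * (((m : ℝ) + 2) * u ^ (m + 1)) ≤ (u + 1 / 2) * (u + 1 / 2) ^ (m + 2) :=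
        mul_le_mul_of_nonneg_left ih (by linarith)
      have h2 : 0 ≤ ((m : ℝ) + 2) * u ^ (m + 1) * (1 / 2 - u) :=
        mul_nonneg (by positivity) (by linarith)
      have h3 : 0 ≤ ((m : ℝ) + 1) * u ^ (m + 2) := by positivity
      push_cast
      calc ((m : ℝ) + 1 + 2) * u ^ (m + 1 + 1)
          ≤ (u + 1 / 2) * (((m : ℝ) + 2) * u ^ (m + 1)) := by
            have e1 : u ^ (m + 1 + 1) = u ^ (m + 1) * u := pow_succ _ _
            have e2 : u ^ (m + 2) = u ^ (m + 1) * u := pow_succ _ _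
            rw [e2] at h3; rw [e1]; nlinarith
        _ ≤ (u + 1 / 2) * (u + 1 / 2) ^ (m + 2) := h1
        _ = _ := by ring
  · rw [max_eq_left (by linarith : 0 ≤ u - 1 / 2)]
    have key : ∀ k : ℕ, (k : ℝ) * u ^ (k - 1) ≤ (u + 1 / 2) ^ k - (u - 1 / 2) ^ k ∧
        2 * u ^ k ≤ (u + 1 / 2) ^ k + (u - 1 / 2) ^ k := by
      intro k
      induction k with
      | zero => norm_num
      | succ k ih =>
        obtain ⟨i1, i2⟩ := ih
        have e : (k : ℝ) * u ^ (k - 1) * u = k * u ^ k := by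
          rcases k with _ | k
          · simp
          · simp [pow_succ, mul_assoc]
        have h4 : 0 ≤ (k : ℝ) * u ^ (k - 1) := by positivity
        constructor
        · push_cast
          rw [pow_succ (u + 1 / 2), pow_succ (u - 1 / 2)]
          nlinarith
        · rw [pow_succ (u + 1 / 2), pow_succ (u - 1 / 2), pow_succ u]
          nlinarith
    have := (key (m + 2)).1
    push_cast at this
    exact this

/-- The sum of `R - ‖x‖₁` over the centres `x` of the unit cells of an orthant is at most its
integral. -/
lemma sum_max_sub_le (N : ℕ) (j : ℕ) (R : ℝ) :
    ∑ x : Fin j → Fin N, max (R - ∑ i, (((x i : ℕ) : ℝ) + 1 / 2)) 0 ≤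
      max R 0 ^ (j + 1) / (j + 1).factorial := by
  induction j generalizing R with
  | zero => simp
  | succ j ih =>
    rw [← (Fin.consEquiv fun _ => Fin N).sum_comp, Fintype.sum_prod_type]
    have h1 : ∀ a : Fin N, ∑ y : Fin j → Fin N,
        max (R - ∑ i, ((((Fin.consEquiv fun _ => Fin N) (a, y) i : Fin N) : ℕ) + 1 / 2 : ℝ)) 0 ≤
        max (R - (a : ℕ)) 0 ^ (j + 2) / (j + 2).factorial -
          max (R - ((a : ℕ) + 1 : ℕ)) 0 ^ (j + 2) / (j + 2).factorial := by
      intro a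
      have h2 := ih (R - (a : ℕ) - 1 / 2)
      have h3 := midpoint_pow_max_le j (R - (a : ℕ) - 1 / 2)
      have e : ((j + 2).factorial : ℝ) = ((j : ℝ) + 2) * (j + 1).factorial := by
        rw [Nat.factorial_succ]; push_cast; ring
      have hf : (0 : ℝ) < (j + 1).factorial := by positivity
      rw [← sub_div, e, le_div_iff₀ (by positivity)]
      rw [le_div_iff₀ hf] at h2
      have h4 : ∑ y : Fin j → Fin N,
        max (R - ∑ i, ((((Fin.consEquiv fun _ => Fin N) (a, y) i : Fin N) : ℕ) + 1 / 2 : ℝ)) 0 =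
        ∑ y : Fin j → Fin N, max (R - (a : ℕ) - 1 / 2 - ∑ i, (((y i : ℕ) : ℝ) + 1 / 2)) 0 := by
        refine Finset.sum_congr rfl fun y _ => ?_
        simp only [Fin.consEquiv_apply, Fin.sum_univ_succ, Fin.cons_zero, Fin.cons_succ]
        congr 1; ring
      rw [h4]
      have e1 : R - (a : ℕ) - 1 / 2 + 1 / 2 = R - (a : ℕ) := by ring
      have e2 : R - (a : ℕ) - 1 / 2 - 1 / 2 = R - ((a : ℕ) + 1 : ℕ) := by push_cast; ring
      rw [e1, e2] at h3
      have hj : (0 : ℝ) ≤ (j : ℝ) + 2 := by positivity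
      nlinarith [mul_le_mul_of_nonneg_left h2 hj]
    refine (Finset.sum_le_sum fun a _ => h1 a).trans ?_
    rw [Fin.sum_univ_eq_sum_range
      (fun a : ℕ => max (R - (a : ℕ)) 0 ^ (j + 2) / (j + 2).factorial -
          max (R - ((a : ℕ) + 1 : ℕ)) 0 ^ (j + 2) / ((j + 2).factorial : ℝ)) N,
      Finset.sum_range_sub']
    have : (0 : ℝ) ≤ max (R - (N : ℕ)) 0 ^ (j + 2) / (j + 2).factorial := by positivity
    simpa using this

/-- Exchanging a heavily weighted coordinate with a larger lightly weighted one. -/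
lemma sum_coord_le_sum_coord {N j : ℕ} (S : Finset (Fin j → Fin N)) (i l : Fin j)
    (hS : ∀ x ∈ S, x l ≤ x i → x ∘ Equiv.swap i l ∈ S) :
    ∑ x ∈ S, ((x i : ℕ) : ℝ) ≤ ∑ x ∈ S, ((x l : ℕ) : ℝ) := by
  classical
  have hinv : ∀ x : Fin j → Fin N, (x ∘ Equiv.swap i l) ∘ Equiv.swap i l = x := by
    intro x; ext k; simp
  rw [← sub_nonneg, ← Finset.sum_sub_distrib,
    ← Finset.sum_filter_add_sum_filter_not S (fun x => x l ≤ x i)]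
  have himg : (S.filter fun x => x l < x i).image (fun x => x ∘ Equiv.swap i l) ⊆
      S.filter fun x => ¬ x l ≤ x i := by
    intro y hy
    simp only [Finset.mem_image, Finset.mem_filter] at hy ⊢
    obtain ⟨x, ⟨hx, hlt⟩, rfl⟩ := hy
    exact ⟨hS x hx hlt.le, by simpa using hlt⟩
  have h1 : ∑ x ∈ S.filter (fun x => x l < x i), (((x i : ℕ) : ℝ) - ((x l : ℕ) : ℝ)) ≤
      ∑ x ∈ S.filter (fun x => ¬ x l ≤ x i), (((x l : ℕ) : ℝ) - ((x i : ℕ) : ℝ)) := by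
    have h2 := Finset.sum_le_sum_of_subset_of_nonneg (f := fun x : Fin j → Fin N =>
      (((x l : ℕ) : ℝ) - ((x i : ℕ) : ℝ))) himg (by
        intro x hx _
        simp only [Finset.mem_filter, not_le] at hx
        have : (x i : ℕ) ≤ x l := hx.2.le
        simpa using (by exact_mod_cast this : ((x i : ℕ) : ℝ) ≤ ((x l : ℕ) : ℝ)))
    rw [Finset.sum_image (fun x _ y _ h => by
      have h' : x ∘ Equiv.swap i l = y ∘ Equiv.swap i l := h
      rw [← hinv x, h', hinv y])] at h2
    simpa using h2
  have h3 : ∑ x ∈ S.filter (fun x => x l ≤ x i), (((x l : ℕ) : ℝ) - ((x i : ℕ) : ℝ)) =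
      ∑ x ∈ S.filter (fun x => x l < x i), (((x l : ℕ) : ℝ) - ((x i : ℕ) : ℝ)) := by
    symm
    apply Finset.sum_subset
    · intro x; simp only [Finset.mem_filter]; exact fun h => ⟨h.1, h.2.le⟩
    · intro x hx hx'
      simp only [Finset.mem_filter, not_and, not_lt] at hx hx'
      have : x l = x i := le_antisymm hx.2 (hx' hx.1)
      simp [this]
  rw [h3]
  have h5 : ∑ x ∈ S.filter (fun x => x l < x i), (((x i : ℕ) : ℝ) - ((x l : ℕ) : ℝ)) =
    - ∑ x ∈ S.filter (fun x => x l < x i), (((x l : ℕ) : ℝ) - ((x i : ℕ) : ℝ)) := by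
    rw [← Finset.sum_neg_distrib]; exact Finset.sum_congr rfl fun _ _ => by ring
  linarith

/-- A finite set of lattice points of an orthant whose `0`-th coordinate is on average the
largest cannot have more points than the simplex with the same average. -/
lemma card_pow_le_of_sum_coord_le {N p : ℕ} (S : Finset (Fin (p + 1) → Fin N))
    (hne : S.Nonempty)
    (hS : ∀ i, ∑ x ∈ S, ((x i : ℕ) : ℝ) ≤ ∑ x ∈ S, ((x 0 : ℕ) : ℝ)) :
    (S.card : ℝ) ^ (p + 2) ≤ ((p : ℝ) + 2) ^ (p + 1) / (2 ^ (p + 1) * (p + 1).factorial) *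
      (∑ x ∈ S, (2 * ((x 0 : ℕ) : ℝ) + 1)) ^ (p + 1) := by
  set Q : ℝ := ∑ x ∈ S, (2 * ((x 0 : ℕ) : ℝ) + 1) with hQ
  have hV : (0 : ℝ) < S.card := by exact_mod_cast hne.card_pos
  set V : ℝ := (S.card : ℝ) with hVdef
  have hQpos : 0 < Q := Finset.sum_pos (fun x _ => by positivity) hne
  set R : ℝ := (p + 2) * Q / (2 * V) with hR
  have hRpos : 0 < R := by positivity
  have h1 : ∑ x ∈ S, (R - ∑ i, (((x i : ℕ) : ℝ) + 1 / 2)) ≤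
      R ^ (p + 2) / (p + 2).factorial := by
    calc _ ≤ ∑ x ∈ S, max (R - ∑ i, (((x i : ℕ) : ℝ) + 1 / 2)) 0 :=
          Finset.sum_le_sum fun _ _ => le_max_left _ _
      _ ≤ ∑ x : Fin (p + 1) → Fin N, max (R - ∑ i, (((x i : ℕ) : ℝ) + 1 / 2)) 0 :=
          Finset.sum_le_sum_of_subset_of_nonneg (Finset.subset_univ _)
            fun _ _ _ => le_max_right _ _
      _ ≤ _ := by
          have := sum_max_sub_le N (p + 1) R
          rwa [max_eq_left hRpos.le] at this
  have h2 : ∑ x ∈ S, ∑ i, (((x i : ℕ) : ℝ) + 1 / 2) ≤ (p + 1) * (Q / 2) := by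
    rw [Finset.sum_comm]
    have h3 : ∀ i ∈ (Finset.univ : Finset (Fin (p + 1))),
        ∑ x ∈ S, (((x i : ℕ) : ℝ) + 1 / 2) ≤ Q / 2 := by
      intro i _
      have e : Q / 2 = ∑ x ∈ S, (((x 0 : ℕ) : ℝ) + 1 / 2) := by
        rw [hQ, Finset.sum_div]; exact Finset.sum_congr rfl fun _ _ => by ring
      rw [e, Finset.sum_add_distrib, Finset.sum_add_distrib]
      linarith [hS i]
    have := Finset.sum_le_sum h3
    simpa using this
  rw [Finset.sum_sub_distrib, Finset.sum_const, nsmul_eq_mul, ← hVdef] at h1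
  have h4 : V * R = (p + 2) * (Q / 2) := by rw [hR]; field_simp
  have h5 : Q / 2 ≤ R ^ (p + 2) / (p + 2).factorial := by nlinarith
  have e : ((p + 2).factorial : ℝ) = ((p : ℝ) + 2) * (p + 1).factorial := by
    rw [Nat.factorial_succ]; push_cast; ring
  rw [hR, e, div_pow, le_div_iff₀ (by positivity), le_div_iff₀ (by positivity)] at h5
  rw [div_mul_eq_mul_div, le_div_iff₀ (by positivity)]
  have h6 : (0 : ℝ) < Q * (p + 2) := by positivity
  refine le_of_mul_le_mul_left ?_ h6
  calc Q * (p + 2) * (V ^ (p + 2) * (2 ^ (p + 1) * (p + 1).factorial))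
      = Q / 2 * ((p + 2) * (p + 1).factorial) * (2 * V) ^ (p + 2) := by ring
    _ ≤ _ := h5
    _ = _ := by rw [mul_pow]; ring

lemma sum_two_mul_add_one_of_isLowerSet {N : ℕ} (T : Finset (Fin N))
    (hT : ∀ a ∈ T, ∀ b ≤ a, b ∈ T) :
    ∑ c ∈ T, (2 * ((c : ℕ) : ℝ) + 1) = (T.card : ℝ) ^ 2 := by
  have hU : T.map Fin.valEmbedding = Finset.range T.card := by
    apply Finset.eq_of_subset_of_card_le
    · intro c hc
      obtain ⟨a, ha, rfl⟩ := Finset.mem_map.1 hc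
      have h1 : Finset.Iic a ⊆ T := fun b hb => hT a ha b (Finset.mem_Iic.1 hb)
      have h2 := Finset.card_le_card h1
      rw [Fin.card_Iic] at h2
      simpa using h2
    · simp
  have h3 : ∑ c ∈ T, (2 * ((c : ℕ) : ℝ) + 1) =
      ∑ c ∈ T.map Fin.valEmbedding, (2 * ((c : ℕ) : ℝ) + 1) := by
    rw [Finset.sum_map]; rfl
  rw [h3, hU]
  generalize T.card = m
  induction m with
  | zero => simp
  | succ m ih => rw [Finset.sum_range_succ, ih]; push_cast; ring

/-- Tuples `(x₀, …, x_{j-1})` with `2 ^ t * (h x₀ + h x₁ + 2 * h x₂ + 4 * h x₃ + ⋯) ≤ w`. -/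
def dyadicBall {N : ℕ} (h : Fin N → ℕ) (j t w : ℕ) : Finset (Fin j → Fin N) :=
  Finset.univ.filter fun x => 2 ^ t * ∑ i : Fin j, 2 ^ ((i : ℕ) - 1) * h (x i) ≤ w

/-- The admissible lowest digits over the given higher digits. -/
def dyadicFiber {N : ℕ} (h : Fin N → ℕ) {p : ℕ} (t w : ℕ) (b : Fin p → Fin N) :
    Finset (Fin N) :=
  Finset.univ.filter fun c => 2 ^ t * (h c + ∑ i : Fin p, 2 ^ (i : ℕ) * h (b i)) ≤ w

lemma sum_dyadicBall {N : ℕ} (h : Fin N → ℕ) (p t w : ℕ) (f : Fin N → ℝ) :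
    ∑ x ∈ dyadicBall h (p + 1) t w, f (x 0) =
      ∑ b : Fin p → Fin N, ∑ c ∈ dyadicFiber h t w b, f c := by
  rw [dyadicBall, Finset.sum_filter, ← (Fin.consEquiv fun _ => Fin N).sum_comp,
    Fintype.sum_prod_type_right]
  refine Finset.sum_congr rfl fun b _ => ?_
  rw [dyadicFiber, Finset.sum_filter]
  refine Finset.sum_congr rfl fun c _ => ?_
  simp [Fin.consEquiv_apply, Fin.sum_univ_succ]

lemma card_dyadicBall {N : ℕ} (h : Fin N → ℕ) (p t w : ℕ) :
    ((dyadicBall h (p + 1) t w).card : ℝ) =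
      ∑ b : Fin p → Fin N, ((dyadicFiber h t w b).card : ℝ) := by
  simpa using sum_dyadicBall h p t w fun _ => 1

lemma sum_dyadicBall_two_mul_add_one {N : ℕ} (h : Fin N → ℕ) (hh : Monotone h) (p t w : ℕ) :
    ∑ x ∈ dyadicBall h (p + 1) t w, (2 * ((x 0 : ℕ) : ℝ) + 1) =
      ∑ b : Fin p → Fin N, ((dyadicFiber h t w b).card : ℝ) ^ 2 := by
  rw [sum_dyadicBall h p t w fun c => 2 * ((c : ℕ) : ℝ) + 1]
  refine Finset.sum_congr rfl fun b _ => sum_two_mul_add_one_of_isLowerSet _ ?_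
  intro a ha c hc
  simp only [dyadicFiber, Finset.mem_filter, Finset.mem_univ, true_and] at ha ⊢
  refine le_trans ?_ ha
  gcongr
  exact hh hc

lemma sum_two_pow_pred (t : ℕ) : ∑ i : Fin (t + 1), 2 ^ ((i : ℕ) - 1) = 2 ^ t := by
  induction t with
  | zero => simp
  | succ t ih => rw [Fin.sum_univ_castSucc]; simp [ih, pow_succ]; ring

/-- Refining the lowest digit into `t + 1` digits. -/
lemma sum_card_dyadicFiber_pow_le {N : ℕ} (h : Fin N → ℕ) (p t w : ℕ) :
    ∑ b : Fin p → Fin N, (dyadicFiber h t w b).card ^ (t + 1) ≤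
      (dyadicBall h (t + 1 + p) 0 w).card := by
  classical
  have e : ∑ b : Fin p → Fin N, (dyadicFiber h t w b).card ^ (t + 1) =
      (Finset.univ.sigma fun b : Fin p → Fin N =>
        Fintype.piFinset fun _ : Fin (t + 1) => dyadicFiber h t w b).card := by
    simp [Finset.card_sigma, Fintype.card_piFinset]
  rw [e]
  refine Finset.card_le_card_of_injOn (fun y => Fin.append y.2 y.1) ?_ ?_
  · rintro ⟨b, c⟩ hy
    simp only [Finset.coe_sigma, Set.mem_sigma_iff, Finset.mem_coe, Fintype.mem_piFinset,
      dyadicFiber, Finset.mem_filter, Finset.mem_univ, true_and, Finset.coe_univ, Set.mem_univ]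
      at hy
    simp only [dyadicBall, Finset.coe_filter, Finset.mem_univ, true_and, Set.mem_ofPred_eq,
      pow_zero, one_mul]
    rw [Fin.sum_univ_add]
    simp only [Fin.append_left, Fin.append_right, Fin.val_castAdd,
      Fin.val_natAdd]
    have e2 : ∀ i : Fin p, 2 ^ (t + 1 + (i : ℕ) - 1) * h (b i) =
        2 ^ t * (2 ^ (i : ℕ) * h (b i)) := by
      intro i
      rw [show t + 1 + (i : ℕ) - 1 = t + i by omega, pow_add]; ring
    simp only [e2, ← Finset.mul_sum]
    set B := ∑ i : Fin p, 2 ^ (i : ℕ) * h (b i)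
    obtain ⟨i0, -, hi0⟩ := Finset.exists_max_image Finset.univ (fun i => h (c i))
      (Finset.univ_nonempty (α := Fin (t + 1)))
    refine le_trans ?_ (hy i0)
    rw [mul_add]
    gcongr
    rw [← sum_two_pow_pred t, Finset.sum_mul]
    exact Finset.sum_le_sum fun i hi => Nat.mul_le_mul_left _ (hi0 i hi)
  · rintro ⟨b, c⟩ _ ⟨b', c'⟩ _ hbc
    have hbc' : Fin.append c b = Fin.append c' b' := hbc
    have h1 : c = c' := by
      funext i
      have := congrFun hbc' (Fin.castAdd p i)
      simpa using this
    have h2 : b = b' := by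
      funext i
      have := congrFun hbc' (Fin.natAdd (t + 1) i)
      simpa using this
    subst h1 h2
    rfl

/-- The constant comparing a dyadic ball with its refinements. -/
noncomputable def simplexConst (j : ℕ) : ℝ := ((j : ℝ) + 1) ^ j / (2 ^ j * j.factorial)

lemma pow_add_le_of_mul_pow_le {V G C W : ℝ} {t p : ℕ} (hV : 0 ≤ V) (hG : 0 ≤ G) (hC : 0 ≤ C)
    (h1 : V ≤ C * G ^ (p + 1)) (h2 : V * G ^ t ≤ W) :
    V ^ (t + 1 + p) ≤ C ^ t * W ^ (p + 1) := by
  calc V ^ (t + 1 + p) = V ^ t * V ^ (p + 1) := by ring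
    _ ≤ (C * G ^ (p + 1)) ^ t * V ^ (p + 1) := by gcongr
    _ = C ^ t * (V * G ^ t) ^ (p + 1) := by
      rw [mul_pow, mul_pow, ← pow_mul, ← pow_mul, mul_comm (p + 1) t]; ring
    _ ≤ C ^ t * W ^ (p + 1) := by gcongr

lemma card_dyadicBall_pow_le {N : ℕ} (h : Fin N → ℕ) (hh : Monotone h) (p t w : ℕ)
    (hne : (dyadicBall h (p + 1) t w).Nonempty) :
    ((dyadicBall h (p + 1) t w).card : ℝ) ^ (t + 1 + p) ≤
      simplexConst (p + 1) ^ t * ((dyadicBall h (t + 1 + p) 0 w).card : ℝ) ^ (p + 1) := by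
  have hV : (0 : ℝ) < (dyadicBall h (p + 1) t w).card := by exact_mod_cast hne.card_pos
  have hswap : ∀ i, ∑ x ∈ dyadicBall h (p + 1) t w, ((x i : ℕ) : ℝ) ≤
      ∑ x ∈ dyadicBall h (p + 1) t w, ((x 0 : ℕ) : ℝ) := by
    intro i
    apply sum_coord_le_sum_coord
    intro x hx hle
    rcases eq_or_ne i 0 with rfl | hi
    · simpa using hx
    simp only [dyadicBall, Finset.mem_filter, Finset.mem_univ, true_and] at hx ⊢
    refine le_trans ?_ hx
    refine Nat.mul_le_mul_left _ ?_
    have hm : ∀ y : Fin (p + 1) → Fin N, ∑ k : Fin (p + 1), 2 ^ ((k : ℕ) - 1) * h (y k) =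
        h (y 0) + 2 ^ ((i : ℕ) - 1) * h (y i) +
          ∑ k ∈ (Finset.univ.erase (0 : Fin (p + 1))).erase i, 2 ^ ((k : ℕ) - 1) * h (y k) := by
      intro y
      rw [← Finset.add_sum_erase _ _ (Finset.mem_univ (0 : Fin (p + 1))),
        ← Finset.add_sum_erase (Finset.univ.erase (0 : Fin (p + 1))) _
          (Finset.mem_erase.2 ⟨hi, Finset.mem_univ i⟩)]
      simp [add_assoc]
    rw [hm, hm]
    refine Nat.add_le_add ?_ (le_of_eq ?_)
    · simp only [Function.comp_apply, Equiv.swap_apply_left, Equiv.swap_apply_right]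
      have h1 : h (x 0) ≤ h (x i) := hh hle
      obtain ⟨d, hd⟩ := Nat.exists_eq_add_of_le h1
      have h2 : 1 ≤ 2 ^ ((i : ℕ) - 1) := Nat.one_le_two_pow
      rw [hd]
      nlinarith
    · refine Finset.sum_congr rfl fun k hk => ?_
      simp only [Finset.mem_erase] at hk
      simp [Equiv.swap_apply_of_ne_of_ne hk.1 hk.2.1]
  have hF2 := card_pow_le_of_sum_coord_le _ hne hswap
  rw [sum_dyadicBall_two_mul_add_one h hh] at hF2
  have hF1 : ∑ b : Fin p → Fin N, ((dyadicFiber h t w b).card : ℝ) ^ (t + 1) ≤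
      ((dyadicBall h (t + 1 + p) 0 w).card : ℝ) := by
    exact_mod_cast sum_card_dyadicFiber_pow_le h p t w
  have hVβ := card_dyadicBall h p t w
  set V : ℝ := ((dyadicBall h (p + 1) t w).card : ℝ)
  set Vs : ℝ := ((dyadicBall h (t + 1 + p) 0 w).card : ℝ)
  set β : (Fin p → Fin N) → ℝ := fun b => ((dyadicFiber h t w b).card : ℝ)
  set Q : ℝ := ∑ b, β b ^ 2 with hQ
  have hβ : ∀ b, 0 ≤ β b := fun b => Nat.cast_nonneg _
  have hQ0 : 0 ≤ Q := Finset.sum_nonneg fun b _ => by positivity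
  have hpm := Real.pow_arith_mean_le_arith_mean_pow Finset.univ (fun b => β b / V) β
    (fun b _ => div_nonneg (hβ b) hV.le) (by rw [← Finset.sum_div, ← hVβ, div_self hV.ne'])
    (fun b _ => hβ b) t
  have e1 : ∑ b, β b / V * β b = Q / V := by
    rw [hQ, Finset.sum_div]; exact Finset.sum_congr rfl fun b _ => by ring
  have e2 : ∑ b, β b / V * β b ^ t = (∑ b, β b ^ (t + 1)) / V := by
    rw [Finset.sum_div]; exact Finset.sum_congr rfl fun b _ => by ring
  rw [e1, e2] at hpm
  have hG : V * (Q / V) ^ t ≤ Vs := by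
    rw [le_div_iff₀ hV] at hpm
    linarith
  have hC : 0 ≤ simplexConst (p + 1) := by unfold simplexConst; positivity
  have hV2 : V ≤ simplexConst (p + 1) * (Q / V) ^ (p + 1) := by
    have e3 : simplexConst (p + 1) =
        ((p : ℝ) + 2) ^ (p + 1) / (2 ^ (p + 1) * (p + 1).factorial) := by
      unfold simplexConst; push_cast; ring_nf
    rw [e3, div_pow Q V, ← mul_div_assoc, le_div_iff₀ (by positivity)]
    calc V * V ^ (p + 1) = V ^ (p + 2) := by ring
      _ ≤ _ := hF2
  have hGn : 0 ≤ Q / V := div_nonneg hQ0 hV.le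
  exact pow_add_le_of_mul_pow_le hV.le hGn hC hV2 hG

lemma leeWt_neg {m : ℕ} [NeZero m] (x : ZMod m) : leeWt (-x) = leeWt x := by
  unfold leeWt
  rcases eq_or_ne x 0 with rfl | hx
  · simp
  · have := NeZero.mk hx
    rw [ZMod.val_neg_of_ne_zero]
    have := x.val_lt
    omega

lemma leeWtVec_neg {n m : ℕ} [NeZero m] (v : Fin n → ZMod m) : leeWtVec (-v) = leeWtVec v :=
  Finset.sum_congr rfl fun i _ => leeWt_neg (v i)

lemma leeWt_natCast {m y : ℕ} [NeZero m] (h : 2 * y ≤ m) : leeWt (y : ZMod m) = y := by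
  have := NeZero.pos m
  unfold leeWt
  rw [ZMod.val_natCast_of_lt (by omega)]
  omega

/-- The residue with lowest bit `f 0` acting as a reflection and the remaining bits as the
binary digits of a multiple of `2 ^ t`. -/
def bitDecode (m t : ℕ) {p : ℕ} (f : Fin (p + 1) → Fin 2) : ZMod m :=
  if f 0 = 0 then ((2 ^ t * ∑ i : Fin p, (f i.succ : ℕ) * 2 ^ (i : ℕ) : ℕ) : ZMod m)
  else -((2 ^ t * (1 + ∑ i : Fin p, (f i.succ : ℕ) * 2 ^ (i : ℕ)) : ℕ) : ZMod m)

lemma leeWt_bitDecode {m t p : ℕ} [NeZero m] (hm : m = 2 ^ t * 2 ^ (p + 1))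
    (f : Fin (p + 1) → Fin 2) :
    leeWt (bitDecode m t f) = 2 ^ t * ∑ i : Fin (p + 1), 2 ^ ((i : ℕ) - 1) * (f i : ℕ) := by
  have h1 : ∑ i : Fin p, (f i.succ : ℕ) * 2 ^ (i : ℕ) < 2 ^ p := by
    have := (finFunctionFinEquiv fun i : Fin p => f i.succ).isLt
    rwa [finFunctionFinEquiv_apply] at this
  have h2 : ∑ i : Fin (p + 1), 2 ^ ((i : ℕ) - 1) * (f i : ℕ) =
      f 0 + ∑ i : Fin p, (f i.succ : ℕ) * 2 ^ (i : ℕ) := by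
    simp [Fin.sum_univ_succ, mul_comm]
  rw [h2]
  set a := ∑ i : Fin p, (f i.succ : ℕ) * 2 ^ (i : ℕ)
  have h3 : 2 * (2 ^ t * (1 + a)) ≤ m := by
    rw [hm, pow_succ]
    calc 2 * (2 ^ t * (1 + a)) = 2 ^ t * ((1 + a) * 2) := by ring
      _ ≤ _ := by gcongr; omega
  unfold bitDecode
  split_ifs with h0
  · rw [leeWt_natCast]
    · simp [h0, a]
    · refine le_trans ?_ h3
      gcongr
      exact Nat.le_add_left _ _
  · have h4 : f 0 = 1 := by omega
    rw [leeWt_neg, leeWt_natCast h3]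
    simp [h4, a]

lemma exists_bitDecode_eq {m t p : ℕ} [NeZero m] (hm : m = 2 ^ t * 2 ^ (p + 1)) (x : ZMod m)
    (hx : 2 ^ (p + 1) • x = 0) : ∃ f : Fin (p + 1) → Fin 2, bitDecode m t f = x := by
  have hdvd : 2 ^ t ∣ x.val := by
    have h1 : ((2 ^ (p + 1) * x.val : ℕ) : ZMod m) = 0 := by
      rw [Nat.cast_mul, ZMod.natCast_zmod_val, ← nsmul_eq_mul, hx]
    rw [ZMod.natCast_eq_zero_iff] at h1
    exact Nat.dvd_of_mul_dvd_mul_left (Nat.two_pow_pos (p + 1))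
      ((Dvd.intro _ (by rw [hm]; ring : 2 ^ (p + 1) * 2 ^ t * 1 = m)).trans h1)
  obtain ⟨y, hy⟩ := hdvd
  have hylt : y < 2 ^ (p + 1) := by
    have := x.val_lt
    rw [hy] at this
    exact Nat.lt_of_mul_lt_mul_left (this.trans_eq hm)
  have hdig : ∀ a < 2 ^ p, ∃ g : Fin p → Fin 2, ∑ i : Fin p, (g i : ℕ) * 2 ^ (i : ℕ) = a := by
    intro a ha
    refine ⟨finFunctionFinEquiv.symm ⟨a, ha⟩, ?_⟩
    rw [← finFunctionFinEquiv_apply]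
    simp
  have hxv : x = ((2 ^ t * y : ℕ) : ZMod m) := by rw [← hy, ZMod.natCast_zmod_val]
  rcases lt_or_ge y (2 ^ p) with h | h
  · obtain ⟨g, hg⟩ := hdig y h
    refine ⟨Fin.cons 0 g, ?_⟩
    simp only [bitDecode, Fin.cons_zero, Fin.cons_succ, if_true, hg, hxv]
  · have h2 : 2 ^ (p + 1) - y - 1 < 2 ^ p := by rw [pow_succ] at hylt ⊢; omega
    obtain ⟨g, hg⟩ := hdig _ h2
    refine ⟨Fin.cons 1 g, ?_⟩
    have h3 : 1 + (2 ^ (p + 1) - y - 1) = 2 ^ (p + 1) - y := by omega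
    simp only [bitDecode, Fin.cons_zero, Fin.cons_succ, one_ne_zero, if_false, hg, h3]
    rw [hxv, neg_eq_iff_add_eq_zero, ← Nat.cast_add, ← mul_add, Nat.sub_add_cancel hylt.le, ← hm,
      ZMod.natCast_self]

lemma bitDecode_injective {m p : ℕ} [NeZero m] (hm : m = 2 ^ (p + 1)) :
    Function.Injective (bitDecode m 0 : (Fin (p + 1) → Fin 2) → ZMod m) := by
  refine ((Fintype.bijective_iff_surjective_and_card _).2 ⟨fun x => ?_, ?_⟩).1
  · refine exists_bitDecode_eq (by simpa using hm) x ?_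
    rw [← hm, nsmul_eq_mul, ZMod.natCast_self, zero_mul]
  · simp [ZMod.card, hm]

/-- The vectors of Lee weight at most `w` whose order divides `2 ^ j`. -/
def torsionBall (n s j w : ℕ) : Finset (Fin n → ZMod (2 ^ s)) :=
  Finset.univ.filter fun v => 2 ^ j • v = 0 ∧ leeWtVec v ≤ w

lemma card_torsionBall_self (n s w : ℕ) : (torsionBall n s s w).card = VL n w (2 ^ s) := by
  rw [VL, Nat.card_eq_fintype_card, Fintype.card_subtype, torsionBall]
  congr 1
  refine Finset.filter_congr fun v _ => and_iff_right ?_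
  funext i
  have h : ((2 ^ s : ℕ) : ZMod (2 ^ s)) = 0 := ZMod.natCast_self _
  simp only [Pi.smul_apply, nsmul_eq_mul, h, zero_mul, Pi.zero_apply]

lemma exists_equiv_monotone_weight (n : ℕ) :
    ∃ e : Fin (2 ^ n) ≃ (Fin n → Fin 2), Monotone fun c => ∑ i, (e c i : ℕ) := by
  let e₀ : Fin (2 ^ n) ≃ (Fin n → Fin 2) := finFunctionFinEquiv.symm
  let g : Fin (2 ^ n) → ℕ := fun c => ∑ i, (e₀ c i : ℕ)
  exact ⟨(Tuple.sort g).trans e₀, Tuple.monotone_sort g⟩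

lemma leeWtVec_bitDecode {n m t p N : ℕ} [NeZero m] (hm : m = 2 ^ t * 2 ^ (p + 1))
    (e : Fin N → Fin n → Fin 2) (x : Fin (p + 1) → Fin N) :
    leeWtVec (fun i => bitDecode m t fun l => e (x l) i) =
      2 ^ t * ∑ l : Fin (p + 1), 2 ^ ((l : ℕ) - 1) * ∑ i, (e (x l) i : ℕ) := by
  simp only [leeWtVec, leeWt_bitDecode hm, Finset.mul_sum]
  rw [Finset.sum_comm]

lemma card_torsionBall_pow_le (n p t w : ℕ) :
    ((torsionBall n (t + 1 + p) (p + 1) w).card : ℝ) ^ (t + 1 + p) ≤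
      simplexConst (p + 1) ^ t * (VL n w (2 ^ (t + 1 + p)) : ℝ) ^ (p + 1) := by
  classical
  obtain ⟨e, he⟩ := exists_equiv_monotone_weight n
  set h : Fin (2 ^ n) → ℕ := fun c => ∑ i, (e c i : ℕ) with hh
  have hm : 2 ^ (t + 1 + p) = 2 ^ t * 2 ^ (p + 1) := by ring
  have h1 : torsionBall n (t + 1 + p) (p + 1) w ⊆ (dyadicBall h (p + 1) t w).image
      fun x i => bitDecode (2 ^ (t + 1 + p)) t fun l => e (x l) i := by
    intro v hv
    simp only [torsionBall, Finset.mem_filter, Finset.mem_univ, true_and] at hv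
    choose f hf using fun i => exists_bitDecode_eq hm (v i) (congrFun hv.1 i)
    refine Finset.mem_image.2 ⟨fun l => e.symm fun i => f i l, ?_, by simp [hf]⟩
    simp only [dyadicBall, Finset.mem_filter, Finset.mem_univ, true_and, hh]
    rw [← leeWtVec_bitDecode hm (fun c => e c)]
    simpa [hf] using hv.2
  have h2 : (dyadicBall h (t + 1 + p) 0 w).card ≤ VL n w (2 ^ (t + 1 + p)) := by
    have key : ∀ r, t + 1 + p = r + 1 →
        (dyadicBall h (r + 1) 0 w).card ≤ VL n w (2 ^ (t + 1 + p)) := by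
      intro r hr
      rw [← card_torsionBall_self]
      refine Finset.card_le_card_of_injOn
        (fun x i => bitDecode (2 ^ (t + 1 + p)) 0 fun l => e (x l) i) ?_ ?_
      · intro x hx
        have hz : ((2 ^ (t + 1 + p) : ℕ) : ZMod (2 ^ (t + 1 + p))) = 0 := ZMod.natCast_self _
        simp only [dyadicBall, Finset.coe_filter, Finset.mem_univ, true_and,
          Set.mem_ofPred_eq] at hx
        simp only [torsionBall, Finset.coe_filter, Finset.mem_univ, true_and, Set.mem_ofPred_eq]
        refine ⟨?_, ?_⟩
        · funext i
          simp only [Pi.smul_apply, nsmul_eq_mul, hz, zero_mul, Pi.zero_apply]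
        · rw [leeWtVec_bitDecode (by rw [hr]; ring) (fun c => e c)]
          exact hx
      · intro x _ y _ hxy
        funext l
        refine e.injective (funext fun i => ?_)
        exact congrFun (bitDecode_injective (by rw [hr]) (congrFun hxy i)) l
    have := key (t + p) (by ring)
    rwa [show t + p + 1 = t + 1 + p by ring] at this
  have hne : (dyadicBall h (p + 1) t w).Nonempty := by
    have : (torsionBall n (t + 1 + p) (p + 1) w).Nonempty :=
      ⟨0, by simp [torsionBall, leeWtVec, leeWt]⟩
    exact (this.mono h1).of_image
  have hC : 0 ≤ simplexConst (p + 1) := by unfold simplexConst; positivity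
  calc ((torsionBall n (t + 1 + p) (p + 1) w).card : ℝ) ^ (t + 1 + p)
      ≤ ((dyadicBall h (p + 1) t w).card : ℝ) ^ (t + 1 + p) := by
        gcongr
        exact (Finset.card_le_card h1).trans Finset.card_image_le
    _ ≤ _ := card_dyadicBall_pow_le h he p t w hne
    _ ≤ _ := by gcongr

section RandomCode

variable {k M s : ℕ}

/-- The systematic encoder whose `c`-th parity check has coefficients `A c`. -/
def systematicEncoder {R : Type*} [CommRing R] (A : Fin M → Fin k → R) :
    (Fin k → R) →+ (Fin (k + M) → R) where
  toFun u := Fin.append u fun c => ∑ i, u i * A c i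
  map_zero' := by
    funext i
    refine Fin.addCases (fun i => ?_) (fun i => ?_) i <;> simp
  map_add' u v := by
    funext i
    refine Fin.addCases (fun i => ?_) (fun i => ?_) i <;>
      simp [add_mul, Finset.sum_add_distrib]

lemma systematicEncoder_injective {R : Type*} [CommRing R] (A : Fin M → Fin k → R) :
    Function.Injective (systematicEncoder A) := by
  intro u v h
  funext i
  have := congrFun h (Fin.castAdd M i)
  simpa [systematicEncoder] using this

lemma card_range_systematicEncoder (A : Fin M → Fin k → ZMod (2 ^ s)) :
    Nat.card (systematicEncoder A).range = (2 ^ s) ^ k := by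
  rw [← Nat.card_congr (AddMonoidHom.ofInjective (systematicEncoder_injective A)).toEquiv]
  simp

lemma card_filter_sum_mul_eq_mul_le (u : Fin k → ZMod (2 ^ s)) (j : ℕ)
    (hu : addOrderOf u = 2 ^ j) (y : ZMod (2 ^ s)) :
    (Finset.univ.filter fun a : Fin k → ZMod (2 ^ s) => ∑ i, u i * a i = y).card * 2 ^ j ≤
      (2 ^ s) ^ k := by
  classical
  let φ : (Fin k → ZMod (2 ^ s)) →+ ZMod (2 ^ s) :=
    { toFun := fun a => ∑ i, u i * a i
      map_zero' := by simp
      map_add' := fun a b => by simp [mul_add, Finset.sum_add_distrib] }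
  have hcard : Nat.card φ.ker * Nat.card φ.range = (2 ^ s) ^ k := by
    have h1 := AddSubgroup.card_eq_card_quotient_mul_card_addSubgroup φ.ker
    rw [Nat.card_congr (QuotientAddGroup.quotientKerEquivRange φ).toEquiv] at h1
    rw [mul_comm, ← h1]
    simp
  rw [← hcard]
  refine Nat.mul_le_mul ?_ ?_
  · rcases (Finset.univ.filter fun a : Fin k → ZMod (2 ^ s) =>
      ∑ i, u i * a i = y).eq_empty_or_nonempty with h | ⟨a₀, ha₀⟩
    · simp [h]
    · rw [Nat.card_eq_fintype_card, Fintype.card_subtype]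
      refine Finset.card_le_card_of_injOn (fun a => a - a₀) ?_
        fun a _ b _ h => sub_left_injective h
      intro a ha
      simp only [Finset.coe_filter, Finset.mem_filter, Finset.mem_univ, true_and,
        Set.mem_ofPred_eq] at ha ha₀ ⊢
      rw [AddMonoidHom.mem_ker, map_sub, sub_eq_zero]
      exact ha.trans ha₀.symm
  · rcases j with _ | j
    · exact Nat.card_pos
    have h1 : ∃ i, 2 ^ j • u i ≠ 0 := by
      by_contra! h
      have h2 : addOrderOf u ∣ 2 ^ j := addOrderOf_dvd_of_nsmul_eq_zero (funext h)
      rw [hu, Nat.pow_dvd_pow_iff_le_right (by norm_num)] at h2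
      omega
    obtain ⟨i, hi⟩ := h1
    have h2 : addOrderOf (u i) = 2 ^ (j + 1) := by
      refine addOrderOf_eq_prime_pow hi ?_
      have := addOrderOf_nsmul_eq_zero u
      rw [hu] at this
      exact congrFun this i
    rw [← h2, ← Nat.card_zmultiples]
    refine Nat.card_le_card_of_injective _ (AddSubgroup.inclusion_injective (K := φ.range) ?_)
    rw [AddSubgroup.zmultiples_le]
    exact ⟨Pi.single i 1, by simp [φ, Pi.single_apply]⟩

lemma card_filter_mem_range_systematicEncoder_mul_le (v : Fin (k + M) → ZMod (2 ^ s)) (j : ℕ)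
    (hv : addOrderOf v = 2 ^ j) [DecidablePred fun A : Fin M → Fin k → ZMod (2 ^ s) =>
      v ∈ (systematicEncoder A).range] :
    (Finset.univ.filter fun A : Fin M → Fin k → ZMod (2 ^ s) =>
      v ∈ (systematicEncoder A).range).card * 2 ^ (j * M) ≤
      Fintype.card (Fin M → Fin k → ZMod (2 ^ s)) := by
  classical
  set u : Fin k → ZMod (2 ^ s) := fun i => v (Fin.castAdd M i) with hu
  have hmem : ∀ A : Fin M → Fin k → ZMod (2 ^ s), v ∈ (systematicEncoder A).range →
      systematicEncoder A u = v := by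
    rintro A ⟨u', rfl⟩
    congr 1
    funext i
    simp [hu, systematicEncoder]
  rcases (Finset.univ.filter fun A : Fin M → Fin k → ZMod (2 ^ s) =>
      v ∈ (systematicEncoder A).range).eq_empty_or_nonempty with h | ⟨A₀, hA₀⟩
  · rw [h]
    simp
  have hord : addOrderOf u = 2 ^ j := by
    rw [← hv, ← hmem A₀ (by simpa using hA₀)]
    exact (addOrderOf_injective _ (systematicEncoder_injective A₀) u).symm
  have hsub : (Finset.univ.filter fun A : Fin M → Fin k → ZMod (2 ^ s) =>
      v ∈ (systematicEncoder A).range) ⊆ Fintype.piFinset fun c => Finset.univ.filter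
        fun a : Fin k → ZMod (2 ^ s) => ∑ i, u i * a i = v (Fin.natAdd k c) := by
    intro A hA
    simp only [Finset.mem_filter, Finset.mem_univ, true_and, Fintype.mem_piFinset] at hA ⊢
    intro c
    have := congrFun (hmem A hA) (Fin.natAdd k c)
    simpa [systematicEncoder] using this
  calc _ ≤ (∏ c : Fin M, (Finset.univ.filter fun a : Fin k → ZMod (2 ^ s) =>
        ∑ i, u i * a i = v (Fin.natAdd k c)).card) * 2 ^ (j * M) := by
        rw [← Fintype.card_piFinset]
        exact Nat.mul_le_mul_right _ (Finset.card_le_card hsub)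
    _ = ∏ c : Fin M, ((Finset.univ.filter fun a : Fin k → ZMod (2 ^ s) =>
        ∑ i, u i * a i = v (Fin.natAdd k c)).card * 2 ^ j) := by
        rw [Finset.prod_mul_distrib, Finset.prod_const, Finset.card_univ, Fintype.card_fin,
          pow_mul]
    _ ≤ ∏ _c : Fin M, (2 ^ s) ^ k :=
        Finset.prod_le_prod' fun c _ => card_filter_sum_mul_eq_mul_le u j hord _
    _ = _ := by simp

lemma one_le_sum_filter_of_neg_mem {G : Type*} [AddCommGroup G] [DecidableEq G] (T : Finset G)
    (hT : ∀ v ∈ T, -v ∈ T) (hne : T.Nonempty) :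
    (1 : ℝ) ≤ ∑ v ∈ T, if 2 • v = 0 then 1 else 1 / 2 := by
  obtain ⟨v, hv⟩ := hne
  have hpos : ∀ x ∈ T, (0 : ℝ) ≤ if 2 • x = 0 then 1 else 1 / 2 := by
    intro x _; split_ifs <;> norm_num
  by_cases h : 2 • v = 0
  · have := Finset.single_le_sum hpos hv
    rwa [if_pos h] at this
  · have hne : v ≠ -v := fun h' => h (by rw [two_nsmul]; nth_rw 2 [h']; exact add_neg_cancel v)
    have h2 : ¬ 2 • (-v) = 0 := by rwa [smul_neg, neg_eq_zero]
    have h3 : ({v, -v} : Finset G) ⊆ T := by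
      intro x hx
      simp only [Finset.mem_insert, Finset.mem_singleton] at hx
      rcases hx with rfl | rfl
      exacts [hv, hT _ hv]
    have := Finset.sum_le_sum_of_subset_of_nonneg h3 fun x hx _ => hpos x hx
    rw [Finset.sum_pair hne, if_neg h, if_neg h2] at this
    linarith

/-- Averaging over all systematic codes, counting vectors that are not of order two in pairs
`±v`. -/
lemma exists_systematicEncoder_lt_leeWtVec (k M s w : ℕ)
    (hlt : ∑ j ∈ Finset.Icc 1 s, (if j = 1 then (1 : ℝ) else 1 / 2) *
      ((torsionBall (k + M) s j w).card / 2 ^ (j * M)) < 1) :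
    ∃ A : Fin M → Fin k → ZMod (2 ^ s), ∀ v ∈ (systematicEncoder A).range, v ≠ 0 →
      w < leeWtVec v := by
  classical
  by_contra! hbad
  refine hlt.not_ge ?_
  set B : Finset (Fin (k + M) → ZMod (2 ^ s)) :=
    Finset.univ.filter fun v => v ≠ 0 ∧ leeWtVec v ≤ w with hB
  set φ : (Fin (k + M) → ZMod (2 ^ s)) → ℝ := fun v => if 2 • v = 0 then 1 else 1 / 2 with hφ
  set c : ℕ → ℝ := fun j => if j = 1 then (1 : ℝ) else 1 / 2 with hc
  have hφ0 : ∀ v, 0 ≤ φ v := fun v => by simp only [hφ]; split_ifs <;> norm_num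
  have hc0 : ∀ j, 0 ≤ c j := fun j => by simp only [hc]; split_ifs <;> norm_num
  set K : ℝ := ((Fintype.card (Fin M → Fin k → ZMod (2 ^ s)) : ℕ) : ℝ) with hK
  have hKpos : 0 < K := by
    rw [hK]; exact_mod_cast Fintype.card_pos
  have h1 : ∀ A : Fin M → Fin k → ZMod (2 ^ s),
      (1 : ℝ) ≤ ∑ v ∈ B, if v ∈ (systematicEncoder A).range then φ v else 0 := by
    intro A
    rw [← Finset.sum_filter]
    refine one_le_sum_filter_of_neg_mem _ ?_ ?_
    · intro v hv
      simp only [hB, Finset.mem_filter, Finset.mem_univ, true_and] at hv ⊢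
      exact ⟨⟨neg_ne_zero.2 hv.1.1, by rw [leeWtVec_neg]; exact hv.1.2⟩, neg_mem hv.2⟩
    · obtain ⟨v, hv, hv0, hvw⟩ := hbad A
      exact ⟨v, by simp [hB, hv0, hvw, -AddMonoidHom.mem_range, hv]⟩
  have h2 : ∀ v ∈ B, φ v * ((Finset.univ.filter fun A : Fin M → Fin k → ZMod (2 ^ s) =>
      v ∈ (systematicEncoder A).range).card : ℝ) ≤
      K * ∑ j ∈ Finset.Icc 1 s, if 2 ^ j • v = 0 then c j / 2 ^ (j * M) else 0 := by
    intro v hv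
    simp only [hB, Finset.mem_filter, Finset.mem_univ, true_and] at hv
    have hv2 : 2 ^ s • v = 0 := by
      funext i
      have h : ((2 ^ s : ℕ) : ZMod (2 ^ s)) = 0 := ZMod.natCast_self _
      simp only [Pi.smul_apply, nsmul_eq_mul, h, zero_mul, Pi.zero_apply]
    obtain ⟨j, hj, hvj⟩ := (Nat.dvd_prime_pow Nat.prime_two).1
      (addOrderOf_dvd_of_nsmul_eq_zero hv2)
    have hj1 : 1 ≤ j := by
      by_contra h
      obtain rfl : j = 0 := by omega
      rw [pow_zero, AddMonoid.addOrderOf_eq_one_iff] at hvj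
      exact hv.1 hvj
    have hφc : φ v ≤ c j := by
      simp only [hφ, hc]
      split_ifs with ha hb
      · exact le_rfl
      · have := addOrderOf_dvd_of_nsmul_eq_zero ha
        rw [hvj] at this
        have h2 := Nat.le_of_dvd (by norm_num) this
        have h3 : 2 ^ 2 ≤ 2 ^ j := Nat.pow_le_pow_right (by norm_num) (by omega)
        omega
      · norm_num
      · norm_num
    have h3 := card_filter_mem_range_systematicEncoder_mul_le (M := M) (k := k) v j hvj
    have h4 : ((Finset.univ.filter fun A : Fin M → Fin k → ZMod (2 ^ s) =>
      v ∈ (systematicEncoder A).range).card : ℝ) ≤ K / 2 ^ (j * M) := by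
      rw [le_div_iff₀ (by positivity), hK]
      exact_mod_cast h3
    have h5 : c j / 2 ^ (j * M) ≤
        ∑ j ∈ Finset.Icc 1 s, if 2 ^ j • v = 0 then c j / 2 ^ (j * M) else 0 := by
      have := Finset.single_le_sum (f := fun j => if 2 ^ j • v = 0 then c j / 2 ^ (j * M) else 0)
        (fun i _ => by split_ifs <;> [exact div_nonneg (hc0 i) (by positivity); exact le_rfl])
        (Finset.mem_Icc.2 ⟨hj1, hj⟩)
      have h6 : 2 ^ j • v = 0 := by rw [← hvj]; exact addOrderOf_nsmul_eq_zero v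
      rwa [if_pos h6] at this
    calc _ ≤ c j * (K / 2 ^ (j * M)) := mul_le_mul hφc h4 (Nat.cast_nonneg _) (hc0 j)
      _ = K * (c j / 2 ^ (j * M)) := by ring
      _ ≤ _ := mul_le_mul_of_nonneg_left h5 hKpos.le
  refine le_of_mul_le_mul_left ?_ hKpos
  calc K * 1 = ∑ _A : Fin M → Fin k → ZMod (2 ^ s), (1 : ℝ) := by simp [hK]
    _ ≤ ∑ A : Fin M → Fin k → ZMod (2 ^ s),
        ∑ v ∈ B, if v ∈ (systematicEncoder A).range then φ v else 0 :=
      Finset.sum_le_sum fun A _ => h1 A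
    _ = ∑ v ∈ B, φ v * ((Finset.univ.filter fun A : Fin M → Fin k → ZMod (2 ^ s) =>
        v ∈ (systematicEncoder A).range).card : ℝ) := by
      rw [Finset.sum_comm]
      refine Finset.sum_congr rfl fun v _ => ?_
      rw [← Finset.sum_filter, Finset.sum_const, nsmul_eq_mul, mul_comm]
    _ ≤ ∑ v ∈ B, K * ∑ j ∈ Finset.Icc 1 s, if 2 ^ j • v = 0 then c j / 2 ^ (j * M) else 0 :=
      Finset.sum_le_sum h2
    _ = K * ∑ j ∈ Finset.Icc 1 s, ∑ v ∈ B, if 2 ^ j • v = 0 then c j / 2 ^ (j * M) else 0 := by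
      rw [← Finset.mul_sum, Finset.sum_comm]
    _ ≤ _ := by
      refine mul_le_mul_of_nonneg_left (Finset.sum_le_sum fun j _ => ?_) hKpos.le
      rw [← Finset.sum_filter, Finset.sum_const, nsmul_eq_mul, mul_div_assoc', mul_comm (c j),
        div_mul_eq_mul_div]
      refine div_le_div_of_nonneg_right (mul_le_mul_of_nonneg_right ?_ (hc0 j)) (by positivity)
      norm_cast
      refine Finset.card_le_card fun v hv => ?_
      simp only [hB, torsionBall, Finset.mem_filter, Finset.mem_univ, true_and] at hv ⊢
      exact ⟨hv.2, hv.1.2⟩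

end RandomCode

lemma simplexConst_succ (j : ℕ) :
    simplexConst (j + 1) = simplexConst j * ((1 + 1 / ((j + 1 : ℕ) : ℝ)) ^ (j + 1) / 2) := by
  have h : (1 : ℝ) + 1 / ((j + 1 : ℕ) : ℝ) = (j + 2) / (j + 1) := by
    push_cast
    field_simp
    ring
  rw [h, simplexConst, simplexConst, Nat.factorial_succ, div_pow]
  push_cast
  rw [show (j : ℝ) + 1 + 1 = j + 2 by ring]
  field_simp
  ring

lemma one_add_one_div_pow_le (n : ℕ) : (1 + 1 / (n : ℝ)) ^ n ≤ 11 / 4 := by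
  rcases Nat.eq_zero_or_pos n with rfl | hn
  · norm_num
  have hn' : (0 : ℝ) < n := by exact_mod_cast hn
  calc (1 + 1 / (n : ℝ)) ^ n ≤ Real.exp (1 / n) ^ n := by
        gcongr
        linarith [Real.add_one_le_exp (1 / (n : ℝ))]
    _ = Real.exp 1 := by rw [← Real.exp_nat_mul, mul_one_div_cancel hn'.ne']
    _ ≤ 11 / 4 := by linarith [Real.exp_one_lt_d9]

lemma simplexConst_add_two_le (i : ℕ) : simplexConst (i + 2) ≤ 8 / 7 * (11 / 8) ^ i := by
  induction i with
  | zero => norm_num [simplexConst]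
  | succ i ih =>
    rw [show i + 1 + 2 = (i + 2) + 1 by ring, simplexConst_succ]
    have h := one_add_one_div_pow_le (i + 2 + 1)
    calc simplexConst (i + 2) * ((1 + 1 / ((i + 2 + 1 : ℕ) : ℝ)) ^ (i + 2 + 1) / 2)
        ≤ 8 / 7 * (11 / 8) ^ i * ((11 / 4) / 2) := by gcongr
      _ = 8 / 7 * (11 / 8) ^ (i + 1) := by ring

/-- The numerical estimate closing the averaging argument. -/
lemma sum_lt_one_of_pow_le {s : ℕ} (hs : 0 < s) {Y : ℝ} {y : ℕ → ℝ} (hY0 : 0 ≤ Y)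
    (hY : Y * (2 ^ s - 1) < 1)
    (hy : ∀ j, 1 ≤ j → j ≤ s → y j ^ s ≤ simplexConst j ^ (s - j) * Y ^ j) :
    ∑ j ∈ Finset.Icc 1 s, (if j = 1 then (1 : ℝ) else 1 / 2) * y j < 1 := by
  have hC1 : simplexConst 1 = 1 := by norm_num [simplexConst]
  have hy1 : y 1 ^ s ≤ Y := by
    have := hy 1 le_rfl hs
    rwa [hC1, one_pow, one_mul, pow_one] at this
  obtain rfl | rfl | h3 : s = 1 ∨ s = 2 ∨ 3 ≤ s := by omega
  · simp only [Finset.Icc_self, Finset.sum_singleton, if_true]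
    norm_num at hY hy1
    linarith
  · have hy2 := hy 2 (by norm_num) le_rfl
    have h2 : y 2 ≤ Y := by
      rw [Nat.sub_self, pow_zero, one_mul] at hy2
      exact le_of_sq_le_sq hy2 hY0
    have h1 : y 1 < 3 / 5 := by
      by_contra! h
      nlinarith
    rw [show Finset.Icc 1 2 = {1, 2} by rfl]
    norm_num
    linarith
  have h8 : (8 : ℝ) ≤ 2 ^ s := by
    calc (8 : ℝ) = 2 ^ 3 := by norm_num
      _ ≤ 2 ^ s := by gcongr; norm_num
  have hYs : 2 ^ s * Y < 8 / 7 := by nlinarith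
  have h1 : y 1 ≤ 53 / 100 := by
    by_contra! h
    have e1 : (53 / 100 : ℝ) ^ s ≤ Y := le_trans (by gcongr) hy1
    have e2 : (1 : ℝ) + s * (6 / 100) ≤ (1 + 6 / 100) ^ s :=
      one_add_mul_le_pow (by norm_num) s
    have e3 : (2 : ℝ) ^ s * (53 / 100) ^ s = (1 + 6 / 100) ^ s := by
      rw [← mul_pow]; norm_num
    have e4 : (3 : ℝ) ≤ s := by exact_mod_cast h3
    have e5 : (2 : ℝ) ^ s * (53 / 100) ^ s ≤ 2 ^ s * Y := by gcongr
    linarith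
  have hj : ∀ i, i + 2 ≤ s → y (i + 2) ≤ 2 / 7 * (11 / 16) ^ i := by
    intro i hi
    set D : ℝ := 8 / 7 * (11 / 8) ^ i with hD
    have hD1 : 8 / 7 ≤ D := by
      have : (1 : ℝ) ≤ (11 / 8) ^ i := one_le_pow₀ (by norm_num)
      rw [hD]; linarith
    have hDe : 2 / 7 * (11 / 16) ^ i = D / 2 ^ (i + 2) := by
      rw [hD, eq_div_iff (by positivity), pow_add]
      have : (11 / 8 : ℝ) ^ i = (11 / 16) ^ i * 2 ^ i := by rw [← mul_pow]; norm_num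
      rw [this]; ring
    rw [hDe]
    have hC0 : 0 ≤ simplexConst (i + 2) := by unfold simplexConst; positivity
    refine le_of_pow_le_pow_left₀ (by omega : s ≠ 0) (by positivity) ?_
    calc y (i + 2) ^ s ≤ simplexConst (i + 2) ^ (s - (i + 2)) * Y ^ (i + 2) :=
          hy _ (by omega) hi
      _ ≤ D ^ (s - (i + 2)) * Y ^ (i + 2) := by
          gcongr
          exact simplexConst_add_two_le i
      _ ≤ D ^ (s - (i + 2)) * (D / 2 ^ s) ^ (i + 2) := by
          gcongr
          rw [le_div_iff₀ (by positivity)]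
          linarith
      _ = (D / 2 ^ (i + 2)) ^ s := by
          rw [div_pow, div_pow, ← pow_mul, ← pow_mul, mul_div_assoc', ← pow_add,
            Nat.sub_add_cancel hi, mul_comm s]
  have key : ∀ r, r + 1 ≤ s →
      ∑ j ∈ Finset.Icc 1 (r + 1), (if j = 1 then (1 : ℝ) else 1 / 2) * y j ≤
        53 / 100 + 16 / 35 * (1 - (11 / 16) ^ r) := by
    intro r
    induction r with
    | zero => intro _; simpa using h1
    | succ r ih =>
      intro hr
      rw [Finset.sum_Icc_succ_top (by omega), if_neg (by omega)]
      have e1 := ih (by omega)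
      have e2 := hj r hr
      rw [pow_succ]
      linarith
  obtain ⟨r, rfl⟩ : ∃ r, s = r + 1 := ⟨s - 1, by omega⟩
  have e1 := key r le_rfl
  have e2 : (0 : ℝ) < (11 / 16) ^ r := by positivity
  linarith

/-- Gilbert–Varshamov bound in the Lee metric, even prime power case. -/
theorem gilbert_varshamov_lee_even (p s n k d : ℕ) (hp : p.Prime) (hs : 0 < s)
    (heven : Even (p ^ s)) (hn : 0 < n) (hk : 0 < k) (hd : 0 < d) (hkn : k ≤ n)
    (hGV : (VL n (d - 1) (p ^ s) : ℝ) <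
      1 + (((p : ℝ) ^ s) ^ (n - k) - 1) / ((p : ℝ) ^ s - 1)) :
    ∃ C : AddSubgroup (Fin n → ZMod (p ^ s)),
      Nat.card C = (p ^ s) ^ k ∧
      ∀ x ∈ C, ∀ y ∈ C, x ≠ y → d ≤ leeWtVec (x - y) := by
  obtain rfl : p = 2 := (hp.even_iff).1 (Nat.even_pow.1 heven).1
  obtain ⟨M, rfl⟩ := Nat.exists_eq_add_of_le hkn
  set w := d - 1 with hw
  set V := VL (k + M) w (2 ^ s) with hV
  have hV' : (V : ℝ) * (2 ^ s - 1) < (2 ^ s) ^ M := by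
    have h2 : (1 : ℝ) < 2 ^ s := one_lt_pow₀ (by norm_num) hs.ne'
    have hg : ∑ i ∈ Finset.range M, ((2 : ℝ) ^ s) ^ i = ((2 ^ s) ^ M - 1) / (2 ^ s - 1) :=
      geom_sum_eq h2.ne' M
    rw [Nat.add_sub_cancel_left] at hGV
    push_cast at hGV
    rw [← hg] at hGV
    have h3 : V ≤ ∑ i ∈ Finset.range M, (2 ^ s) ^ i := by
      have : V < 1 + ∑ i ∈ Finset.range M, (2 ^ s) ^ i := by exact_mod_cast hGV
      omega
    have h4 : (V : ℝ) ≤ ((2 ^ s) ^ M - 1) / (2 ^ s - 1) := by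
      rw [← hg]; exact_mod_cast h3
    rw [le_div_iff₀ (by linarith)] at h4
    linarith
  have hlt := sum_lt_one_of_pow_le (s := s) (Y := V / 2 ^ (s * M))
    (y := fun j => ((torsionBall (k + M) s j w).card : ℝ) / 2 ^ (j * M)) hs (by positivity)
    (by
      rw [div_mul_eq_mul_div, div_lt_one (by positivity), pow_mul]
      exact hV')
    (by
      intro j hj1 hjs
      obtain ⟨b, rfl⟩ : ∃ b, j = b + 1 := ⟨j - 1, by omega⟩
      obtain ⟨t, rfl⟩ : ∃ t, s = t + 1 + b := ⟨s - (b + 1), by omega⟩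
      have := card_torsionBall_pow_le (k + M) b t w
      rw [show t + 1 + b - (b + 1) = t by omega, div_pow, div_pow, ← pow_mul, ← pow_mul,
        mul_div_assoc', show (t + 1 + b) * M * (b + 1) = (b + 1) * M * (t + 1 + b) by ring]
      exact div_le_div_of_nonneg_right this (by positivity))
  obtain ⟨A, hA⟩ := exists_systematicEncoder_lt_leeWtVec k M s w hlt
  refine ⟨(systematicEncoder A).range, card_range_systematicEncoder A, fun x hx y hy hxy => ?_⟩
  have := hA (x - y) (sub_mem hx hy) (sub_ne_zero.2 hxy)
  omega
end

section
/- Let p be a prime, s ≥ 2 and K positive integers, and let v be a nonnegative integer divisible by p. Then the number of vectors x ∈ p·(ℤ/p^sℤ)^K with Lee weight wt_L(x) = v equals F_L(K, v/p, p^{s−1}), the number of vectors in (ℤ/p^{s−1}ℤ)^K of Lee weight v/p. -/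
/-- `FL n w m` is the number of vectors in `(ℤ/mℤ)^n` of Lee weight exactly `w`. -/
noncomputable def FL (n w m : ℕ) : ℕ :=
  Nat.card {v : Fin n → ZMod m // leeWtVec v = w}

/-- The embedding `ℤ/mℤ → ℤ/pmℤ` sending `y` to `p * y`. -/
def scaleZMod (p m : ℕ) (y : ZMod m) : ZMod (p * m) := ((p * y.val : ℕ) : ZMod (p * m))

section

variable {p m : ℕ} [NeZero m]

theorem val_scaleZMod (hp : 0 < p) (y : ZMod m) : (scaleZMod p m y).val = p * y.val :=
  ZMod.val_cast_of_lt (Nat.mul_lt_mul_of_pos_left (ZMod.val_lt y) hp)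

theorem leeWt_scaleZMod (hp : 0 < p) (y : ZMod m) : leeWt (scaleZMod p m y) = p * leeWt y := by
  rw [leeWt, leeWt, val_scaleZMod hp, ← Nat.mul_sub, Nat.mul_min_mul_left]

theorem leeWtVec_scaleZMod (hp : 0 < p) {n : ℕ} (y : Fin n → ZMod m) :
    leeWtVec (fun i => scaleZMod p m (y i)) = p * leeWtVec y := by
  simp only [leeWtVec, leeWt_scaleZMod hp, Finset.mul_sum]

theorem scaleZMod_injective (hp : 0 < p) : Function.Injective (scaleZMod p m) := fun a b h =>
  ZMod.val_injective m <| Nat.eq_of_mul_eq_mul_left hp <| by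
    rw [← val_scaleZMod hp, ← val_scaleZMod hp, h]

theorem dvd_scaleZMod (y : ZMod m) : (p : ZMod (p * m)) ∣ scaleZMod p m y :=
  ⟨(y.val : ZMod (p * m)), by simp [scaleZMod]⟩

theorem exists_scaleZMod_eq (hp : 0 < p) {x : ZMod (p * m)} (hx : (p : ZMod (p * m)) ∣ x) :
    ∃ y, scaleZMod p m y = x := by
  obtain ⟨c, rfl⟩ := hx
  have : NeZero (p * m) := ⟨mul_ne_zero hp.ne' (NeZero.ne m)⟩
  refine ⟨(c.val : ZMod m), ?_⟩
  rw [scaleZMod, ZMod.val_natCast, ← Nat.mul_mod_mul_left, ZMod.natCast_mod, Nat.cast_mul,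
    ZMod.natCast_zmod_val]

theorem card_multiples_leeWtVec_eq (hp : 0 < p) (n w : ℕ) :
    Nat.card {x : Fin n → ZMod (p * m) //
        (∀ i, (p : ZMod (p * m)) ∣ x i) ∧ leeWtVec x = p * w} = FL n w m := by
  refine (Nat.card_congr (Equiv.ofBijective (fun y : {y : Fin n → ZMod m // leeWtVec y = w} =>
    ⟨fun i => scaleZMod p m (y.1 i), fun i => dvd_scaleZMod (y.1 i), by
      rw [leeWtVec_scaleZMod hp, y.2]⟩) ⟨fun a b h => ?_, ?_⟩)).symm
  · exact Subtype.ext <| funext fun i =>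
      scaleZMod_injective hp (congrFun (congrArg Subtype.val h) i)
  · rintro ⟨x, hx, hw⟩
    choose y hy using fun i => exists_scaleZMod_eq hp (hx i)
    obtain rfl : (fun i => scaleZMod p m (y i)) = x := funext hy
    rw [leeWtVec_scaleZMod hp] at hw
    exact ⟨⟨y, Nat.eq_of_mul_eq_mul_left hp hw⟩, rfl⟩

end

/-- The number of vectors in `p·(ℤ/p^sℤ)^K` of Lee weight `v` equals the number of
vectors in `(ℤ/p^{s-1}ℤ)^K` of Lee weight `v/p`. -/
theorem count_p_multiples_of_lee_weight (p s K v : ℕ) (hp : p.Prime) (hs : 2 ≤ s)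
    (hK : 0 < K) (hv : p ∣ v) :
    Nat.card {x : Fin K → ZMod (p ^ s) //
        (∀ i, (p : ZMod (p ^ s)) ∣ x i) ∧ leeWtVec x = v} =
      FL K (v / p) (p ^ (s - 1)) := by
  have : NeZero (p ^ (s - 1)) := ⟨pow_ne_zero _ hp.ne_zero⟩
  obtain ⟨w, rfl⟩ := hv
  have h : p ^ s = p * p ^ (s - 1) := (mul_pow_sub_one (by omega) p).symm
  rw [Nat.mul_div_cancel_left w hp.pos, h]
  exact card_multiples_leeWtVec_eq hp.pos K w
end

section
/- Let R be a finite ring with identity and wt : R → ℝ_{≥0} a function with wt(0) = 0, wt(1) = 1, and wt(x) ≥ 1 for all x ≠ 0, extended additively to vectors by wt(x) = ∑_i wt(x_i). Let T be a finite set of size t, U = {a_1, …, a_u} ⊆ T × T × T, and let H^⊤ ∈ R^{u×3t} be the 0-1 matrix whose rows are indexed by U and whose columns by three copies of T, with entry (i, j) equal to 1 exactly when the corresponding coordinate of a_i equals the corresponding element of T (first coordinate for columns 1..t, second for columns t+1..2t, third for columns 2t+1..3t). If e ∈ R^u satisfies wt(e) ≤ t and e·H^⊤ equals the all-one vector of length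 3t, then every entry of e lies in {0, 1}, e has exactly t nonzero entries, and the set W = {a_i : e_i = 1} has size t and no two elements of W agree in any of the three coordinates. -/
/-- The `c`-th coordinate (for `c : Fin 3`) of a triple. -/
def coord3 {T : Type*} (c : Fin 3) (a : T × T × T) : T :=
  if c = 0 then a.1 else if c = 1 then a.2.1 else a.2.2

/-- The 0-1 matrix `H^⊤` built from a list `a` of triples: rows are indexed by the
triples, columns by three copies of `T`, and entry `(i, (c, b))` is `1` exactly when
the `c`-th coordinate of `a i` equals `b`. -/
def matching3DMMatrix (R : Type*) [Zero R] [One R] {T : Type*} [DecidableEq T]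
    {u : ℕ} (a : Fin u → T × T × T) : Matrix (Fin u) (Fin 3 × T) R :=
  fun i cb => if coord3 cb.1 (a i) = cb.2 then 1 else 0

theorem vecMul_matching3DMMatrix_apply {R : Type*} [Ring R] {T : Type*} [DecidableEq T]
    {u : ℕ} (a : Fin u → T × T × T) (e : Fin u → R) (c : Fin 3) (b : T) :
    Matrix.vecMul e (matching3DMMatrix R a) (c, b) =
      ∑ i, if coord3 c (a i) = b then e i else 0 := by
  simp [Matrix.vecMul, dotProduct, matching3DMMatrix]

theorem exists_ne_zero_of_vecMul_matching3DMMatrix {R : Type*} [Ring R] [Nontrivial R]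
    {T : Type*} [DecidableEq T] {u : ℕ} {a : Fin u → T × T × T} {e : Fin u → R}
    (hsyn : Matrix.vecMul e (matching3DMMatrix R a) = fun _ => 1) (c : Fin 3) (b : T) :
    ∃ i, e i ≠ 0 ∧ coord3 c (a i) = b := by
  by_contra! h
  have hsum := vecMul_matching3DMMatrix_apply a e c b
  rw [hsyn, Finset.sum_eq_zero] at hsum
  · exact one_ne_zero hsum
  · intro i _
    split_ifs with hi
    · by_contra hne
      exact h i hne hi
    · rfl

theorem card_support_le_sum_weight {R : Type*} [Zero R] [DecidableEq R]
    {wt : R → ℝ} (hnn : ∀ x, 0 ≤ wt x) (hpos : ∀ x, x ≠ 0 → 1 ≤ wt x)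
    {ι : Type*} [Fintype ι] (e : ι → R) :
    ((Finset.univ.filter fun i => e i ≠ 0).card : ℝ) ≤ ∑ i, wt (e i) := by
  rw [Finset.card_filter, Nat.cast_sum]
  refine Finset.sum_le_sum fun i _ => ?_
  split_ifs with hi
  · simpa using hpos _ hi
  · simpa using hnn (e i)

/-- A low-weight solution of the syndrome equation built from a 3DM instance is a 0-1
vector of support size `t` whose support yields a 3-dimensional matching. -/
theorem sdp_solution_gives_3dm_matching
    {R : Type*} [Ring R] [Fintype R] [DecidableEq R]
    {T : Type*} [Fintype T] [DecidableEq T]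
    (wt : R → ℝ) (hnn : ∀ x, 0 ≤ wt x) (h0 : wt 0 = 0) (h1 : wt 1 = 1)
    (hpos : ∀ x, x ≠ 0 → 1 ≤ wt x)
    {u : ℕ} (a : Fin u → T × T × T) (ha : Function.Injective a)
    (e : Fin u → R)
    (hwt : ∑ i, wt (e i) ≤ (Fintype.card T : ℝ))
    (hsyn : Matrix.vecMul e (matching3DMMatrix R a) = fun _ => 1) :
    (∀ i, e i = 0 ∨ e i = 1) ∧
    (Finset.univ.filter fun i => e i ≠ 0).card = Fintype.card T ∧
    ((Finset.univ.filter fun i => e i = 1).image a).card = Fintype.card T ∧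
    (∀ i j, e i = 1 → e j = 1 → i ≠ j →
      (a i).1 ≠ (a j).1 ∧ (a i).2.1 ≠ (a j).2.1 ∧ (a i).2.2 ≠ (a j).2.2) := by
  have : Nontrivial R := ⟨1, 0, fun h => by simp [h, h0] at h1⟩
  set S := Finset.univ.filter fun i => e i ≠ 0 with hS
  have hle : S.card ≤ Fintype.card T := by
    exact_mod_cast (card_support_le_sum_weight hnn hpos e).trans hwt
  have hsurj (c : Fin 3) : Set.SurjOn (fun i => coord3 c (a i)) S
      (Finset.univ : Finset T) := by
    intro b _
    obtain ⟨i, hi, hb⟩ := exists_ne_zero_of_vecMul_matching3DMMatrix hsyn c b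
    exact ⟨i, by simp [hS, hi], hb⟩
  have hcard : S.card = Fintype.card T :=
    hle.antisymm (Finset.card_le_card_of_surjOn _ (hsurj 0))
  have hinj (c : Fin 3) : Set.InjOn (fun i => coord3 c (a i)) S :=
    Finset.injOn_of_surjOn_of_card_le _ (fun _ _ => by simp) (hsurj c) hle
  have hone (i : Fin u) (hi : e i ≠ 0) : e i = 1 := by
    have hsum := vecMul_matching3DMMatrix_apply a e 0 (coord3 0 (a i))
    rw [hsyn, Finset.sum_eq_single i] at hsum
    · simpa using hsum.symm
    · intro j _ hji
      split_ifs with hj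
      · by_contra hne
        exact hji (hinj 0 (by simp [hS, hne]) (by simp [hS, hi]) hj)
      · rfl
    · simp
  have hsupp : (Finset.univ.filter fun i => e i = 1) = S := by
    ext i
    simp only [hS, Finset.mem_filter, Finset.mem_univ, true_and]
    exact ⟨fun h => h ▸ one_ne_zero, hone i⟩
  refine ⟨fun i => or_iff_not_imp_left.2 (hone i), hcard, ?_, fun i j hi hj hij => ?_⟩
  · rw [hsupp, Finset.card_image_of_injective _ ha, hcard]
  · have hne (c : Fin 3) : coord3 c (a i) ≠ coord3 c (a j) := fun h =>
      hij (hinj c (by simp [hS, hi]) (by simp [hS, hj]) h)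
    exact ⟨hne 0, hne 1, hne 2⟩
end

section
/- Let R be a finite ring with identity and wt : R → ℝ_{≥0} a function with wt(0) = 0, wt(1) = 1, and wt(x) ≥ 1 for all x ≠ 0, extended additively to vectors. Let T be a finite set of size t, U = {a_1, …, a_u} ⊆ T × T × T, and let H^⊤ ∈ R^{u×3t} be the 0-1 matrix constructed from U as follows: entry (i, j) equals 1 exactly when the corresponding coordinate of a_i equals the corresponding element of T (first coordinate for columns 1..t, second for columns t+1..2t, third for columns 2t+1..3t). If W ⊆ U has |W| = t and no two elements of W agree in any coordinate, then the indicator vector e ∈ R^u with e_i = 1 if a_i ∈ W and e_i = 0 otherwise satisfies wt(e) = t and e·H^⊤ equals the all-one vector of length 3t. -/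
/-- An injective map from a finite set with as many elements as the codomain
takes every value exactly once. -/
theorem Finset.card_filter_eq_one_of_injOn {ι T : Type*} [Fintype T] [DecidableEq T]
    {W : Finset ι} (hW : W.card = Fintype.card T) {f : ι → T} (hf : Set.InjOn f W) (b : T) :
    (W.filter fun i => f i = b).card = 1 := by
  have himage : W.image f = Finset.univ :=
    Finset.eq_univ_of_card _ (by rw [Finset.card_image_of_injOn hf, hW])
  obtain ⟨i, hi, rfl⟩ := Finset.mem_image.mp (himage ▸ Finset.mem_univ b)
  refine Finset.card_eq_one.mpr ⟨i, Finset.ext fun j => ?_⟩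
  rw [Finset.mem_filter, Finset.mem_singleton]
  exact ⟨fun h => hf h.1 hi h.2, by rintro rfl; exact ⟨hi, rfl⟩⟩

/-- The indicator vector of a 3-dimensional matching has weight `t` and its syndrome
is the all-one vector. -/
theorem matching_gives_sdp_solution
    {R : Type*} [Ring R] [Fintype R]
    {T : Type*} [Fintype T] [DecidableEq T]
    (wt : R → ℝ) (hnn : ∀ x, 0 ≤ wt x) (h0 : wt 0 = 0) (h1 : wt 1 = 1)
    (hpos : ∀ x, x ≠ 0 → 1 ≤ wt x)
    {u : ℕ} (a : Fin u → T × T × T) (ha : Function.Injective a)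
    (W : Finset (Fin u)) (hW : W.card = Fintype.card T)
    (hmatch : ∀ i ∈ W, ∀ j ∈ W, i ≠ j →
      (a i).1 ≠ (a j).1 ∧ (a i).2.1 ≠ (a j).2.1 ∧ (a i).2.2 ≠ (a j).2.2) :
    (∑ i, wt (if i ∈ W then (1 : R) else 0)) = (Fintype.card T : ℝ) ∧
    Matrix.vecMul (fun i => if i ∈ W then (1 : R) else 0) (matching3DMMatrix R a) =
      fun _ => 1 := by
  constructor
  · simp [apply_ite wt, h0, h1, hW]
  · funext ⟨c, b⟩
    have hinj : Set.InjOn (fun i => coord3 c (a i)) W := by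
      intro i hi j hj hij
      by_contra hne
      obtain ⟨hfst, hsnd, hthd⟩ := hmatch i hi j hj hne
      fin_cases c <;> simp_all [coord3]
    have hcard := Finset.card_filter_eq_one_of_injOn hW hinj b
    simp only [Matrix.vecMul, dotProduct, matching3DMMatrix, ite_mul, one_mul, zero_mul,
      Finset.sum_ite_mem, Finset.univ_inter, Finset.sum_boole, hcard, Nat.cast_one]
end

section
/- Let R be a finite ring with identity and wt : R → ℝ_{≥0} a function with wt(0) = 0, wt(1) = 1, and wt(x) ≥ 1 for all x ≠ 0, extended additively to vectors; let M be the maximum of wt over R. Let t, u be positive integers, H̄^⊤ ∈ R^{u×3t} any matrix, and let H^⊤ ∈ R^{(3tMu+3t+u)×(3tMu+3t)} be the block matrix whose first block row is (H̄^⊤ | Id_u | ⋯ | Id_u) with the u×u identity repeated 3tM times, whose second block row is (−Id_{3t} | 0 | ⋯ | 0), and whose remaining 3tM block rows place −Id_u under the i-th identity copy and zeros elsewhere. If c = (c̄, c_0, c_1, …, c_{3tM}) with c̄ ∈ R^u, c_0 ∈ R^{3t}, c_i ∈ R^u satisfies c·H^⊤ = 0, then c_0 = c̄·H̄^⊤,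 c_i = c̄ for all i, and wt(c) = wt(c̄·H̄^⊤) + (3tM + 1)·wt(c̄). -/
/-- The block matrix `H^⊤` built from `H̄^⊤` (with columns indexed by `γ`), with `N`
copies of the `u × u` identity appended to the first block row, `-Id` blocks below
each identity, and `-Id_γ` below `H̄^⊤`. -/
def bigMatrix (R : Type*) [Ring R] {u : ℕ} {γ : Type*} [DecidableEq γ] {N : ℕ}
    (Hbar : Matrix (Fin u) γ R) :
    Matrix (Fin u ⊕ (γ ⊕ (Fin N × Fin u))) (γ ⊕ (Fin N × Fin u)) R :=
  fun r c =>
    match r, c with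
    | Sum.inl i, Sum.inl j => Hbar i j
    | Sum.inl i, Sum.inr (_, j) => if i = j then 1 else 0
    | Sum.inr (Sum.inl i), Sum.inl j => if i = j then -1 else 0
    | Sum.inr (Sum.inl _), Sum.inr _ => 0
    | Sum.inr (Sum.inr _), Sum.inl _ => 0
    | Sum.inr (Sum.inr (k, i)), Sum.inr (k', j) => if k = k' ∧ i = j then -1 else 0

/-- The entry of `c · H^⊤` in a column of the block `H̄^⊤`. -/
theorem vecMul_bigMatrix_inl {R : Type*} [Ring R] {u N : ℕ} {γ : Type*} [Fintype γ]
    [DecidableEq γ] (Hbar : Matrix (Fin u) γ R) (cbar : Fin u → R) (c0 : γ → R)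
    (cs : Fin N × Fin u → R) (j : γ) :
    Matrix.vecMul (Sum.elim cbar (Sum.elim c0 cs)) (bigMatrix R Hbar) (Sum.inl j) =
      Matrix.vecMul cbar Hbar j - c0 j := by
  simp [Matrix.vecMul, dotProduct, bigMatrix, sub_eq_add_neg]

/-- The entry of `c · H^⊤` in a column of the `k`-th identity block. -/
theorem vecMul_bigMatrix_inr {R : Type*} [Ring R] {u N : ℕ} {γ : Type*} [Fintype γ]
    [DecidableEq γ] (Hbar : Matrix (Fin u) γ R) (cbar : Fin u → R) (c0 : γ → R)
    (cs : Fin N × Fin u → R) (k : Fin N) (j : Fin u) :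
    Matrix.vecMul (Sum.elim cbar (Sum.elim c0 cs)) (bigMatrix R Hbar) (Sum.inr (k, j)) =
      cbar j - cs (k, j) := by
  simp [Matrix.vecMul, dotProduct, bigMatrix, sub_eq_add_neg, Fintype.sum_prod_type, ite_and]

/-- Any vector in the kernel of the big block matrix has the form
`(c̄, c̄·H̄^⊤, c̄, …, c̄)` and its weight is `wt(c̄·H̄^⊤) + (3tM+1)·wt(c̄)`. -/
theorem big_matrix_kernel_structure
    {R : Type*} [Ring R] [Fintype R]
    (wt : R → ℝ) (hnn : ∀ x, 0 ≤ wt x) (h0 : wt 0 = 0) (h1 : wt 1 = 1)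
    (hpos : ∀ x, x ≠ 0 → 1 ≤ wt x)
    (M : ℕ) (hM : ∀ x : R, wt x ≤ (M : ℝ)) (hMmax : ∃ x : R, wt x = (M : ℝ))
    (t u : ℕ) (ht : 0 < t) (hu : 0 < u)
    (Hbar : Matrix (Fin u) (Fin (3 * t)) R)
    (cbar : Fin u → R) (c0 : Fin (3 * t) → R) (cs : Fin (3 * t * M) × Fin u → R)
    (hker : Matrix.vecMul (Sum.elim cbar (Sum.elim c0 cs)) (bigMatrix R Hbar) = 0) :
    c0 = Matrix.vecMul cbar Hbar ∧
    (∀ k i, cs (k, i) = cbar i) ∧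
    (∑ i, wt (cbar i)) + (∑ j, wt (c0 j)) + (∑ ki, wt (cs ki)) =
      (∑ j, wt (Matrix.vecMul cbar Hbar j)) +
        ((3 * t * M : ℕ) + 1 : ℝ) * ∑ i, wt (cbar i) := by
  have hc0 : c0 = Matrix.vecMul cbar Hbar := by
    funext j
    have h := congrFun hker (Sum.inl j)
    rw [vecMul_bigMatrix_inl] at h
    exact (sub_eq_zero.mp h).symm
  have hcs : ∀ k i, cs (k, i) = cbar i := by
    intro k i
    have h := congrFun hker (Sum.inr (k, i))
    rw [vecMul_bigMatrix_inr] at h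
    exact (sub_eq_zero.mp h).symm
  refine ⟨hc0, hcs, ?_⟩
  rw [← hc0, Fintype.sum_prod_type]
  simp only [hcs, Finset.sum_const, Finset.card_univ, Fintype.card_fin, nsmul_eq_mul]
  ring
end

section
/- Let R be a finite ring with identity and wt : R → ℝ_{≥0} a function with wt(0) = 0, wt(1) = 1, and wt(x) ≥ 1 for all x ≠ 0, extended additively to vectors; let M be the maximum of wt over R, attained at some x ∈ R, and assume 3tM is a positive integer. Let T be a finite set of size t, U = {a_1, …, a_u} ⊆ T × T × T, let H̄^⊤ ∈ R^{u×3t} be the 0-1 matrix constructed from U (entry (i,j) = 1 exactly when the relevant coordinate of a_i equals the relevant element of T), and let H^⊤ ∈ R^{(3tMu+3t+u)×(3tMu+3t)} be the stacked block matrix with first block row (H̄^⊤ | Id_u | ⋯ | Id_u) (3tM copies of Id_u), second block row (−Id_{3t} | 0 | ⋯ | 0), and for each i ∈ {1, …, 3tM} a block row with −Id_u under the i-th identity copy and zeros elsewhere. If W ⊆ U has |W| = t and no two elements of W agree in any coordinate, then the vector c = (c̄, c_0, c_1, …, c_{3tM}) with c̄ = x·e (where e is the 0-1 indicator vector of W),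 c_0 = c̄·H̄^⊤, and c_i = c̄ for all i, satisfies c·H^⊤ = 0 and wt(c) = 3t²M² + 4tM. -/
/-- The vector `(v, v·H̄^⊤, v, …, v)` lies in the kernel of the block matrix. -/
lemma vecMul_bigMatrix_eq_zero {R : Type*} [Ring R] {u N : ℕ} {γ : Type*} [Fintype γ]
    [DecidableEq γ] (Hbar : Matrix (Fin u) γ R) (v : Fin u → R) :
    Matrix.vecMul (Sum.elim v (Sum.elim (Matrix.vecMul v Hbar) fun ki : Fin N × Fin u => v ki.2))
      (bigMatrix R Hbar) = 0 := by
  ext j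
  rcases j with j | ⟨k, j⟩
  · simp [Matrix.vecMul, dotProduct, bigMatrix, Fintype.sum_sum_type]
  · have h : ∀ p : Fin N × Fin u, (p.1 = k ∧ p.2 = j) ↔ p = (k, j) := fun p => by
      rw [Prod.ext_iff]
    simp [Matrix.vecMul, dotProduct, bigMatrix, Fintype.sum_sum_type, h]

/-- A map that is injective on a finset with as many elements as the codomain hits every value
exactly once, so summing a constant over the fibre returns that constant. -/
lemma sum_ite_mem_mul_ite_eq {R ι T : Type*} [NonAssocSemiring R] [Fintype ι] [DecidableEq ι]
    [Fintype T] [DecidableEq T] (x : R) (W : Finset ι) (hW : W.card = Fintype.card T)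
    (f : ι → T) (hf : Set.InjOn f W) (b : T) :
    ∑ i, (if i ∈ W then x else 0) * (if f i = b then 1 else 0) = x := by
  have himage : W.image f = Finset.univ :=
    Finset.eq_univ_of_card _ (by rw [Finset.card_image_of_injOn hf, hW])
  obtain ⟨i, hi, rfl⟩ := Finset.mem_image.mp (himage ▸ Finset.mem_univ b)
  rw [Finset.sum_eq_single i]
  · simp [hi]
  · intro j _ hji
    by_cases hj : j ∈ W
    · simp [hf.ne hj hi hji]
    · simp [hj]
  · simp

/-- From a 3-dimensional matching `W` one obtains a kernel vector of the big block
matrix of weight exactly `3t²M² + 4tM`. -/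
theorem matching_gives_given_weight_codeword
    {R : Type*} [Ring R] [Fintype R]
    {T : Type*} [Fintype T] [DecidableEq T]
    (wt : R → ℝ) (hnn : ∀ y, 0 ≤ wt y) (h0 : wt 0 = 0) (h1 : wt 1 = 1)
    (hpos : ∀ y, y ≠ 0 → 1 ≤ wt y)
    (M : ℕ) (hMpos : 0 < M) (hM : ∀ y : R, wt y ≤ (M : ℝ))
    (x : R) (hx : wt x = (M : ℝ))
    {u : ℕ} (a : Fin u → T × T × T) (ha : Function.Injective a)
    (ht : 0 < Fintype.card T)
    (W : Finset (Fin u)) (hW : W.card = Fintype.card T)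
    (hmatch : ∀ i ∈ W, ∀ j ∈ W, i ≠ j →
      (a i).1 ≠ (a j).1 ∧ (a i).2.1 ≠ (a j).2.1 ∧ (a i).2.2 ≠ (a j).2.2) :
    let cbar : Fin u → R := fun i => if i ∈ W then x else 0
    let c0 : Fin 3 × T → R := Matrix.vecMul cbar (matching3DMMatrix R a)
    let cs : Fin (3 * Fintype.card T * M) × Fin u → R := fun ki => cbar ki.2
    Matrix.vecMul (Sum.elim cbar (Sum.elim c0 cs))
        (bigMatrix R (matching3DMMatrix R a)) = 0 ∧
    (∑ i, wt (cbar i)) + (∑ j, wt (c0 j)) + (∑ ki, wt (cs ki)) =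
      ((3 * Fintype.card T ^ 2 * M ^ 2 + 4 * Fintype.card T * M : ℕ) : ℝ) := by
  intro cbar c0 cs
  refine ⟨vecMul_bigMatrix_eq_zero _ cbar, ?_⟩
  have hinj : ∀ c : Fin 3, Set.InjOn (fun i => coord3 c (a i)) W := by
    intro c i hi j hj hij
    by_contra hne
    obtain ⟨h₁, h₂, h₃⟩ := hmatch i hi j hj hne
    fin_cases c <;> simp_all [coord3]
  have hc0 : ∀ j, c0 j = x := fun j =>
    sum_ite_mem_mul_ite_eq x W hW (fun i => coord3 j.1 (a i)) (hinj j.1) j.2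
  have hcbar : ∑ i, wt (cbar i) = Fintype.card T * M := by
    simp [cbar, apply_ite wt, h0, hx, hW]
  have hcs : ∑ ki, wt (cs ki) = (3 * Fintype.card T * M : ℕ) * (Fintype.card T * M : ℝ) := by
    rw [Fintype.sum_prod_type]
    simp [cs, hcbar]
  rw [hcbar, hcs]
  simp only [hc0, hx, Finset.sum_const, Finset.card_univ, Fintype.card_prod, Fintype.card_fin,
    nsmul_eq_mul]
  push_cast
  ring
end
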